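/- arXiv:2310.09128 — 5 statements merged into one kernel-verified Lean document; each statement's English description precedes it below -/
import Mathlib

section
/- Let G be a graph, let F be a set of graphs each member of which is a cycle, let x ∈ V(G), and let Y ⊆ V(G) \ {x} be such that N[Y] ∩ V(G − Y) ⊆ {x} and the subgraph of G induced by {x} ∪ Y contains no subgraph isomorphic to a member of F. Then ι(G, F) = ι(G − Y, F). -/
open SimpleGraph

/-- The closed neighbourhood `N[D]` of a set `D` of vertices of `G`. -/
def closedNbhd {V : Type*} (G : SimpleGraph V) (D : Set V) : Set V :=
  D ∪ {v | ∃ u ∈ D, G.Adj u v}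

/-- `G` contains a subgraph isomorphic to `H` (a copy of `H`). -/
def HasCopy {W V : Type*} (H : SimpleGraph W) (G : SimpleGraph V) : Prop :=
  ∃ f : W ↪ V, ∀ ⦃a b⦄, H.Adj a b → G.Adj (f a) (f b)

/-- `D` is an `H`-isolating set of `G` (single graph `H`). -/
def IsIsolating {W V : Type*} (H : SimpleGraph W) (G : SimpleGraph V) (D : Set V) : Prop :=
  ¬ HasCopy H (G.induce (closedNbhd G D)ᶜ)

/-- The `H`-isolation number of `G` (single graph `H`). -/
noncomputable def isolNum {W V : Type*} (H : SimpleGraph W) (G : SimpleGraph V) : ℕ :=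
  sInf {k | ∃ D : Set V, D.ncard = k ∧ IsIsolating H G D}

/-- `D` is an `F`-isolating set of `G`, for a set `F` of graphs. -/
def IsIsolatingFam {V : Type*} (F : Set ((n : ℕ) × SimpleGraph (Fin n)))
    (G : SimpleGraph V) (D : Set V) : Prop :=
  ∀ H ∈ F, ¬ HasCopy H.2 (G.induce (closedNbhd G D)ᶜ)

/-- The `F`-isolation number of `G`, for a set `F` of graphs. -/
noncomputable def isolNumFam {V : Type*} (F : Set ((n : ℕ) × SimpleGraph (Fin n)))
    (G : SimpleGraph V) : ℕ :=
  sInf {k | ∃ D : Set V, D.ncard = k ∧ IsIsolatingFam F G D}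

/-- The 4-cycle. -/
def C4 : SimpleGraph (Fin 4) := cycleGraph 4

/-- The diamond graph: a 4-cycle together with a chord. -/
def diamondGraph : SimpleGraph (Fin 4) :=
  fromEdgeSet {s(0, 1), s(1, 2), s(2, 3), s(3, 0), s(0, 2)}

/-- The complete graph on 4 vertices. -/
def K4 : SimpleGraph (Fin 4) := ⊤

/-- `G₁`: the square of the 9-cycle. -/
def Gr1 : SimpleGraph (Fin 9) :=
  fromEdgeSet {s(0, 1), s(1, 2), s(2, 3), s(3, 4), s(4, 5), s(5, 6), s(6, 7), s(7, 8), s(8, 0),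
    s(0, 2), s(1, 3), s(2, 4), s(3, 5), s(4, 6), s(5, 7), s(6, 8), s(7, 0), s(8, 1)}

/-- `G₂`. -/
def Gr2 : SimpleGraph (Fin 9) :=
  fromEdgeSet {s(0, 1), s(0, 5), s(0, 6), s(0, 8), s(1, 2), s(1, 7), s(1, 8), s(2, 3), s(2, 6),
    s(2, 7), s(3, 4), s(3, 6), s(3, 8), s(4, 5), s(4, 7), s(4, 8), s(5, 6), s(5, 7)}

/-- `G₃`. -/
def Gr3 : SimpleGraph (Fin 9) :=
  fromEdgeSet {s(0, 1), s(0, 5), s(0, 6), s(0, 8), s(1, 2), s(1, 7), s(1, 8), s(2, 3), s(2, 7),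
    s(2, 8), s(3, 4), s(3, 6), s(3, 8), s(4, 5), s(4, 6), s(4, 7), s(5, 6), s(5, 7)}

/-- `G₄`. -/
def Gr4 : SimpleGraph (Fin 9) :=
  fromEdgeSet {s(0, 1), s(0, 2), s(0, 3), s(0, 4), s(1, 2), s(1, 5), s(1, 6), s(2, 5), s(2, 6),
    s(3, 4), s(3, 7), s(3, 8), s(4, 7), s(4, 8), s(5, 6), s(5, 8), s(6, 7), s(7, 8)}

/-- `G₅`: `G₄` with the edge `{2,3}` removed. -/
def Gr5 : SimpleGraph (Fin 9) :=
  fromEdgeSet {s(0, 1), s(0, 2), s(0, 3), s(0, 4), s(1, 5), s(1, 6), s(2, 5), s(2, 6),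
    s(3, 4), s(3, 7), s(3, 8), s(4, 7), s(4, 8), s(5, 6), s(5, 8), s(6, 7), s(7, 8)}

/-- `G₆`: `G₅` with the edge `{4,5}` removed. -/
def Gr6 : SimpleGraph (Fin 9) :=
  fromEdgeSet {s(0, 1), s(0, 2), s(0, 3), s(0, 4), s(1, 5), s(1, 6), s(2, 5), s(2, 6),
    s(3, 7), s(3, 8), s(4, 7), s(4, 8), s(5, 6), s(5, 8), s(6, 7), s(7, 8)}

/-- The set `𝒢₄ = {C₄, C₄', K₄}` of 4-vertex exceptional graphs. -/
def calG4 : Set ((n : ℕ) × SimpleGraph (Fin n)) := {⟨4, C4⟩, ⟨4, diamondGraph⟩, ⟨4, K4⟩}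

/-- The set `𝒢₉ = {G₁, …, G₆}` of 9-vertex exceptional graphs. -/
def calG9 : Set ((n : ℕ) × SimpleGraph (Fin n)) :=
  {⟨9, Gr1⟩, ⟨9, Gr2⟩, ⟨9, Gr3⟩, ⟨9, Gr4⟩, ⟨9, Gr5⟩, ⟨9, Gr6⟩}

/-- The set `ℰ₄ = 𝒢₄ ∪ 𝒢₉` of exceptional graphs. -/
def calE4 : Set ((n : ℕ) × SimpleGraph (Fin n)) := calG4 ∪ calG9

open Fin.CommRing in
/-- A predicate on the vertices of a cycle that propagates along edges avoiding `w` is constant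
away from `w`. -/
lemma cycleGraph_propagate {n : ℕ} {P : Fin (n + 3) → Prop} {w : Fin (n + 3)}
    (h : ∀ a b, (cycleGraph (n + 3)).Adj a b → a ≠ w → b ≠ w → P a → P b)
    {a b : Fin (n + 3)} (ha : a ≠ w) (hb : b ≠ w) (hP : P a) : P b := by
  have hne : ∀ i : ℕ, i + 1 < n + 3 → w + ((i + 1 : ℕ) : Fin (n + 3)) ≠ w := by
    intro i hi hw
    have h0 : ((i + 1 : ℕ) : Fin (n + 3)) = 0 := by simpa using hw
    have h1 := congrArg Fin.val h0
    rw [Fin.val_natCast, Nat.mod_eq_of_lt hi] at h1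
    simp at h1
  have hstep : ∀ i : ℕ, i + 1 < n + 3 →
      (P (w + ((i + 1 : ℕ) : Fin (n + 3))) ↔ P (w + 1)) := by
    intro i
    induction i with
    | zero => simp
    | succ i ih =>
      intro hi
      rw [← ih (by omega)]
      have hadj : (cycleGraph (n + 3)).Adj (w + ((i + 1 : ℕ) : Fin (n + 3)))
          (w + ((i + 1 + 1 : ℕ) : Fin (n + 3))) := by
        rw [cycleGraph_adj]
        right
        rw [Nat.cast_succ (i + 1)]
        abel
      exact ⟨h _ _ hadj.symm (hne _ hi) (hne _ (by omega)),
        h _ _ hadj (hne _ (by omega)) (hne _ hi)⟩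
  have hrep : ∀ c : Fin (n + 3), c ≠ w → (P c ↔ P (w + 1)) := by
    intro c hc
    have hpos : (c - w).val ≠ 0 := fun h0 =>
      hc (sub_eq_zero.mp (Fin.ext h0))
    obtain ⟨i, hi⟩ := Nat.exists_eq_succ_of_ne_zero hpos
    have hlt : i + 1 < n + 3 := by have := (c - w).isLt; omega
    have hcw : c = w + ((i + 1 : ℕ) : Fin (n + 3)) := by
      have hcast : ((i + 1 : ℕ) : Fin (n + 3)) = c - w := by
        simpa only [hi] using Fin.cast_val_eq_self (c - w)
      rw [hcast]
      abel
    rw [hcw]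
    exact hstep i hlt
  exact (hrep b hb).2 ((hrep a ha).1 hP)

lemma hasCopy_induce_iff {W V : Type*} {H : SimpleGraph W} {G : SimpleGraph V} {S : Set V} :
    HasCopy H (G.induce S) ↔
      ∃ f : W ↪ V, (∀ ⦃a b⦄, H.Adj a b → G.Adj (f a) (f b)) ∧ ∀ a, f a ∈ S := by
  constructor
  · rintro ⟨f, hf⟩
    exact ⟨f.trans (Function.Embedding.subtype _), fun a b hab => hf hab, fun a => (f a).2⟩
  · rintro ⟨f, hf, hS⟩
    exact ⟨⟨fun a => ⟨f a, hS a⟩, fun a b hab => f.injective (congrArg Subtype.val hab)⟩,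
      fun a b hab => hf hab⟩

/-- A copy of a cycle cannot meet both sides of a cut vertex. -/
lemma range_subset_or_of_cycle {W V : Type*} {H : SimpleGraph W} {k : ℕ} (hk : 3 ≤ k)
    (e : H ≃g cycleGraph k) {G : SimpleGraph V} {x : V} {Y : Set V}
    (hN : closedNbhd G Y ∩ Yᶜ ⊆ {x}) (f : W ↪ V) (hf : ∀ ⦃a b⦄, H.Adj a b → G.Adj (f a) (f b)) :
    (∀ a, f a ∈ {x} ∪ Y) ∨ ∀ a, f a ∈ Yᶜ := by
  obtain ⟨n, rfl⟩ := Nat.exists_eq_add_of_le' hk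
  by_contra! hcon
  obtain ⟨⟨b, hb⟩, a, ha⟩ := hcon
  have hbx : f b ≠ x := fun h => hb (Or.inl h)
  have hbY : f b ∉ Y := fun h => hb (Or.inr h)
  have haY : f a ∈ Y := not_not.mp ha
  have hcross : ∀ ⦃u v⦄, G.Adj u v → u ∈ Y → v ≠ x → v ∈ Y := fun u v huv hu hv =>
    by_contra fun hvY => hv (hN ⟨Or.inr ⟨u, hu, huv⟩, hvY⟩)
  obtain ⟨w, haw, hbw, hw⟩ : ∃ w : Fin (n + 3), e a ≠ w ∧ e b ≠ w ∧
      ∀ c, c ≠ w → f (e.symm c) ≠ x ∨ x ∈ Y := by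
    by_cases hx : ∃ c, f c = x ∧ x ∉ Y
    · obtain ⟨c, rfl, hc⟩ := hx
      refine ⟨e c, ?_, ?_, fun d hd => Or.inl fun h => hd ?_⟩
      · rintro h
        exact hc (e.injective h ▸ haY)
      · rintro h
        exact hbx (congrArg f (e.injective h))
      · rw [← f.injective h, e.apply_symm_apply]
    · push Not at hx
      obtain ⟨w, hw⟩ := Finset.exists_mem_notMem_of_card_lt_card
        (s := {e a, e b}) (t := Finset.univ)
        (lt_of_le_of_lt Finset.card_le_two (by simp))
      simp only [Finset.mem_insert, Finset.mem_singleton, not_or] at hw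
      exact ⟨w, Ne.symm hw.2.1, Ne.symm hw.2.2, fun c _ => or_iff_not_imp_left.2 fun h =>
        hx _ (not_not.mp h)⟩
  have key := cycleGraph_propagate (P := fun c => f (e.symm c) ∈ Y) (w := w)
    (fun c d hcd _ hd hc => (hw d hd).elim
      (hcross (hf (e.symm.map_adj_iff.2 hcd)) hc)
      (fun hxmem => by_contra fun hdY =>
        hdY (hcross (hf (e.symm.map_adj_iff.2 hcd)) hc fun hdx => hdY (hdx ▸ hxmem)))) haw hbw
  simp only [e.symm_apply_apply] at key
  exact hbY (key haY)

lemma Nat.sInf_eq_of_forall_exists_le {A B : Set ℕ} (hAB : ∀ a ∈ A, ∃ b ∈ B, b ≤ a)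
    (hBA : ∀ b ∈ B, ∃ a ∈ A, a ≤ b) : sInf A = sInf B := by
  rcases A.eq_empty_or_nonempty with rfl | hA
  · rcases B.eq_empty_or_nonempty with rfl | ⟨b, hb⟩
    · rfl
    · obtain ⟨a, ha, -⟩ := hBA b hb
      exact ha.elim
  · obtain ⟨b, hb, hb'⟩ := hAB _ (Nat.sInf_mem hA)
    obtain ⟨a, ha, ha'⟩ := hBA _ (Nat.sInf_mem ⟨b, hb⟩)
    exact le_antisymm ((Nat.sInf_le ha).trans ha') ((Nat.sInf_le hb).trans hb')

/-- If `D` isolates `G` and `N_G[D] \ Y ⊆ N_{G - Y}[D']`, then `D'` isolates `G - Y`. -/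
lemma IsIsolatingFam.induce_compl {V : Type*} {F : Set ((n : ℕ) × SimpleGraph (Fin n))}
    {G : SimpleGraph V} {Y D : Set V} {D' : Set ↥Yᶜ} (hD : IsIsolatingFam F G D)
    (h : ∀ v : ↥Yᶜ, (v : V) ∈ closedNbhd G D → v ∈ closedNbhd (G.induce Yᶜ) D') :
    IsIsolatingFam F (G.induce Yᶜ) D' := by
  intro H hH hcopy
  obtain ⟨f, hf, hS⟩ := hasCopy_induce_iff.1 hcopy
  exact hD H hH (hasCopy_induce_iff.2 ⟨f.trans (Function.Embedding.subtype _),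
    fun a b hab => hf hab, fun a ha => hS a (h _ ha)⟩)

/-- If `𝓕` is a set of cycles, `x ∈ V(G)`, `Y ⊆ V(G) \ {x}`, `N[Y] ∩ V(G − Y) ⊆ {x}` and the
subgraph induced by `{x} ∪ Y` contains no `𝓕`-graph, then `ι(G, 𝓕) = ι(G − Y, 𝓕)`. -/
theorem stmt4 {V : Type*} [Fintype V] (G : SimpleGraph V)
    (F : Set ((n : ℕ) × SimpleGraph (Fin n)))
    (hF : ∀ H ∈ F, ∃ k, 3 ≤ k ∧ Nonempty (H.2 ≃g cycleGraph k))
    (x : V) (Y : Set V) (hxY : x ∉ Y)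
    (hN : closedNbhd G Y ∩ Yᶜ ⊆ {x})
    (hno : ∀ H ∈ F, ¬ HasCopy H.2 (G.induce ({x} ∪ Y))) :
    isolNumFam F G = isolNumFam F (G.induce Yᶜ) := by
  refine Nat.sInf_eq_of_forall_exists_le ?_ ?_
  · rintro _ ⟨D, rfl, hD⟩
    have hinj : ∀ S : Set V, ((↑) ⁻¹' S : Set ↥Yᶜ).ncard ≤ S.ncard := fun S => by
      rw [← Set.ncard_image_of_injective _ Subtype.val_injective]
      exact Set.ncard_le_ncard (Set.image_preimage_subset _ _) S.toFinite
    by_cases hDY : ∃ y ∈ D, y ∈ Y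
    · obtain ⟨y, hyD, hyY⟩ := hDY
      refine ⟨_, ⟨(↑) ⁻¹' insert x (D \ Y), rfl, hD.induce_compl ?_⟩, (hinj _).trans ?_⟩
      · rintro ⟨v, hv⟩ (hvD | ⟨u, huD, huv⟩)
        · exact Or.inl (Or.inr ⟨hvD, hv⟩)
        · by_cases huY : u ∈ Y
          · exact Or.inl (Or.inl (hN ⟨Or.inr ⟨u, huY, huv⟩, hv⟩))
          · exact Or.inr ⟨⟨u, huY⟩, Or.inr ⟨huD, huY⟩, huv⟩
      · exact (Set.ncard_insert_le _ _).trans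
          (Set.ncard_lt_ncard ⟨Set.sdiff_subset, fun h => (h hyD).2 hyY⟩ D.toFinite)
    · push Not at hDY
      refine ⟨_, ⟨(↑) ⁻¹' D, rfl, hD.induce_compl ?_⟩, hinj D⟩
      rintro ⟨v, hv⟩ (hvD | ⟨u, huD, huv⟩)
      · exact Or.inl hvD
      · exact Or.inr ⟨⟨u, hDY u huD⟩, huD, huv⟩
  · rintro _ ⟨D, rfl, hD⟩
    refine ⟨_, ⟨(↑) '' D, rfl, fun H hH hcopy => ?_⟩,
      (Set.ncard_image_of_injective _ Subtype.val_injective).le⟩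
    obtain ⟨f, hf, hS⟩ := hasCopy_induce_iff.1 hcopy
    obtain ⟨k, hk, ⟨e⟩⟩ := hF H hH
    rcases range_subset_or_of_cycle hk e hN f hf with hxf | hYf
    · exact hno H hH (hasCopy_induce_iff.2 ⟨f, hf, hxf⟩)
    · refine hD H hH (hasCopy_induce_iff.2
        ⟨⟨fun a => ⟨f a, hYf a⟩, fun a b hab => f.injective (congrArg Subtype.val hab)⟩,
          fun a b hab => hf hab, fun a ha => hS a ?_⟩)
      rcases ha with ha | ⟨u, hu, hua⟩
      · exact Or.inl ⟨_, ha, rfl⟩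
      · exact Or.inr ⟨u, ⟨u, hu, rfl⟩, hua⟩
end

section
/- Let G be a graph, let F be a set of graphs each member of which is a cycle, let x ∈ V(G), and let Y ⊆ V(G) \ {x} be such that N[Y] ∩ V(G − Y) ⊆ {x} and the subgraph of G induced by {x} ∪ Y contains no subgraph isomorphic to a member of F. Then every F-isolating set of G − Y is an F-isolating set of G. -/
open SimpleGraph

/-- A property of vertices that is invariant along the edges of a cycle avoiding a vertex `c`
is constant on the vertices other than `c`. -/
theorem iff_of_cycleGraph_adj_ne {n : ℕ} {c : Fin (n + 3)} {P : Fin (n + 3) → Prop}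
    (hP : ∀ a b, (cycleGraph (n + 3)).Adj a b → a ≠ c → b ≠ c → (P a ↔ P b))
    {a b : Fin (n + 3)} (ha : a ≠ c) (hb : b ≠ c) : P a ↔ P b := by
  have key : ∀ m : ℕ, ∀ a, (a - c).val = m + 1 → (P a ↔ P (c + 1)) := by
    intro m
    induction m with
    | zero =>
      intro a ha
      have h : a - c = 1 := Fin.ext ha
      rw [sub_eq_iff_eq_add'.mp h]
    | succ m ih =>
      intro a ha
      have hac : a - c ≠ 0 := fun h => by simp [h] at ha
      have hpred : (a - 1 - c).val = m + 1 := by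
        rw [sub_right_comm, Fin.val_sub_one_of_ne_zero hac, ha, Nat.add_sub_cancel]
      refine (hP a (a - 1) ?_ (sub_ne_zero.mp hac) ?_).trans (ih _ hpred)
      · rw [cycleGraph_adj]
        exact Or.inl (sub_sub_cancel a 1)
      · intro h
        simp [h] at hpred
  have all : ∀ a, a ≠ c → (P a ↔ P (c + 1)) := fun a ha =>
    key ((a - c).val - 1) a
      (Nat.succ_pred_eq_of_ne_zero fun h => ha (sub_eq_zero.mp (Fin.ext h))).symm
  exact (all a ha).trans (all b hb).symm

/-- If every edge leaving the vertex set `{a | P a}` of a cycle has its outer end in a set `S` that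
is disjoint from it and has at most one element, then `{a | P a}` is empty or its union with `S`
is the whole vertex set. -/
theorem cycleGraph_forall_or_forall_not {n : ℕ} {P : Fin (n + 3) → Prop} {S : Set (Fin (n + 3))}
    (hS : S.Subsingleton) (hPS : ∀ a ∈ S, ¬ P a)
    (hP : ∀ a b, (cycleGraph (n + 3)).Adj a b → P a → ¬ P b → b ∈ S) :
    (∀ a, a ∈ S ∨ P a) ∨ ∀ a, ¬ P a := by
  by_contra! h
  obtain ⟨⟨a, haS, ha⟩, b, hb⟩ := h
  have hbS : b ∉ S := fun h => hPS b h hb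
  rcases S.eq_empty_or_nonempty with rfl | ⟨c, hc⟩
  · obtain ⟨w⟩ := cycleGraph_preconnected b a
    induction w with
    | nil => exact ha hb
    | @cons u v w hadj _ ih =>
      by_cases h : P v
      · exact ih ha h haS (by simp)
      · exact hP _ _ hadj hb h
  · refine ha ((iff_of_cycleGraph_adj_ne (c := c) ?_ ?_ ?_).mp hb)
    · intro u v huv hu hv
      constructor
      · intro h
        by_contra h'
        exact hv (hS (hP _ _ huv h h') hc)
      · intro h
        by_contra h'
        exact hu (hS (hP _ _ huv.symm h h') hc)
    · rintro rfl
      exact hbS hc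
    · rintro rfl
      exact haS hc

/-- If `𝓕` is a set of cycles, `x ∈ V(G)`, `Y ⊆ V(G) \ {x}`, `N[Y] ∩ V(G − Y) ⊆ {x}` and the
subgraph induced by `{x} ∪ Y` contains no `𝓕`-graph, then every `𝓕`-isolating set of `G − Y`
is an `𝓕`-isolating set of `G`. -/
theorem stmt5 {V : Type*} [Fintype V] (G : SimpleGraph V)
    (F : Set ((n : ℕ) × SimpleGraph (Fin n)))
    (hF : ∀ H ∈ F, ∃ k, 3 ≤ k ∧ Nonempty (H.2 ≃g cycleGraph k))
    (x : V) (Y : Set V) (hxY : x ∉ Y)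
    (hN : closedNbhd G Y ∩ Yᶜ ⊆ {x})
    (hno : ∀ H ∈ F, ¬ HasCopy H.2 (G.induce ({x} ∪ Y))) :
    ∀ D : Set ↥(Yᶜ), IsIsolatingFam F (G.induce Yᶜ) D →
      IsIsolatingFam F G (Subtype.val '' D) := by
  rintro D hD H hH ⟨f, hf⟩
  obtain ⟨k, hk, ⟨e⟩⟩ := hF H hH
  obtain ⟨n, rfl⟩ := Nat.exists_eq_add_of_le' hk
  have hadj : ∀ a b, H.2.Adj a b → G.Adj (f a).1 (f b).1 := fun a b h => hf h
  have hinj : ∀ a b, (f a).1 = (f b).1 → a = b := fun a b h => f.injective (Subtype.ext h)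
  rcases cycleGraph_forall_or_forall_not (P := fun a => (f (e.symm a)).1 ∈ Y)
    (S := {a | (f (e.symm a)).1 = x})
    (fun a ha b hb => e.symm.injective (hinj _ _ (ha.trans hb.symm)))
    (fun a ha h => hxY (ha ▸ h))
    (fun a b hab ha hb => hN ⟨Or.inr ⟨_, ha, hadj _ _ (e.symm.map_adj_iff.mpr hab)⟩, hb⟩)
    with h | h
  · have hmem : ∀ a, (f a).1 ∈ ({x} ∪ Y : Set V) := fun a => by simpa using h (e a)
    exact hno H hH ⟨⟨fun a => ⟨f a, hmem a⟩, fun a b hab => hinj _ _ (congrArg (fun z => z.1) hab)⟩,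
      fun a b hab => hadj a b hab⟩
  · have hmem : ∀ a, (f a).1 ∈ Yᶜ := fun a => by simpa using h (e a)
    have hmem' : ∀ a, (⟨f a, hmem a⟩ : ↥Yᶜ) ∈ (closedNbhd (G.induce Yᶜ) D)ᶜ := by
      rintro a (ha | ⟨u, hu, hua⟩)
      · exact (f a).2 (Or.inl ⟨_, ha, rfl⟩)
      · exact (f a).2 (Or.inr ⟨u, ⟨u, hu, rfl⟩, hua⟩)
    exact hD H hH ⟨⟨fun a => ⟨⟨f a, hmem a⟩, hmem' a⟩,
      fun a b hab => hinj _ _ (congrArg (fun z => z.1.1) hab)⟩, fun a b hab => hadj a b hab⟩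
end

section
/- If n ≤ 9 and G is a connected graph on n vertices with maximum degree at most 3 that is not a G_4-graph, then ι(G, C_4) ≤ 1. -/
open SimpleGraph

/-- `a, b, c, d` are, in this order, the vertices of a 4-cycle of `G`. -/
structure IsFourCycle {V : Type*} (G : SimpleGraph V) (a b c d : V) : Prop where
  ab : G.Adj a b
  bc : G.Adj b c
  cd : G.Adj c d
  da : G.Adj d a
  ac : a ≠ c
  bd : b ≠ d

theorem IsFourCycle.rotate {V : Type*} {G : SimpleGraph V} {a b c d : V}
    (h : IsFourCycle G a b c d) : IsFourCycle G b c d a :=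
  ⟨h.bc, h.cd, h.da, h.ab, h.bd, h.ac.symm⟩

/-- `p, q, r, s` are, in this order, the vertices of a 4-cycle of `G` which is disjoint from the
closed neighbourhood of `v`. -/
structure IsFourCycleMissing {V : Type*} (G : SimpleGraph V) (v p q r s : V) : Prop extends
    IsFourCycle G p q r s where
  missing : ∀ x, (x = p ∨ x = q ∨ x = r ∨ x = s) → x ≠ v ∧ ¬ G.Adj v x

theorem IsFourCycleMissing.rotate {V : Type*} {G : SimpleGraph V} {v p q r s : V}
    (h : IsFourCycleMissing G v p q r s) : IsFourCycleMissing G v q r s p :=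
  ⟨h.toIsFourCycle.rotate, fun x hx => h.missing x (by clear h; tauto)⟩

/-- In a graph with more than one vertex needed to isolate all 4-cycles, each closed
neighbourhood misses some 4-cycle. -/
theorem exists_fourCycle_of_one_lt_isolNum {V : Type*} {G : SimpleGraph V}
    (h : 1 < isolNum C4 G) (v : V) :
    ∃ p q r s, IsFourCycleMissing G v p q r s := by
  have hv : ¬ IsIsolating C4 G {v} := fun hv =>
    absurd (Nat.sInf_le (s := {k | ∃ D : Set V, D.ncard = k ∧ IsIsolating C4 G D})
      ⟨{v}, Set.ncard_singleton v, hv⟩) (not_le.mpr h)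
  obtain ⟨f, hf⟩ := not_not.mp hv
  have hmem (i : Fin 4) : (f i : V) ≠ v ∧ ¬ G.Adj v (f i) := by
    have := (f i).2
    simpa [closedNbhd] using this
  have hadj (i j : Fin 4) (hij : C4.Adj i j) : G.Adj (f i) (f j) := hf hij
  have hne (i j : Fin 4) (hij : i ≠ j) : (f i : V) ≠ f j := fun e =>
    hij (f.injective (Subtype.ext e))
  refine ⟨f 0, f 1, f 2, f 3, ⟨⟨hadj 0 1 ?_, hadj 1 2 ?_, hadj 2 3 ?_, hadj 3 0 ?_,
    hne 0 2 (by decide), hne 1 3 (by decide)⟩, ?_⟩⟩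
  any_goals
    simp only [C4, cycleGraph_adj]
    decide
  rintro x (rfl | rfl | rfl | rfl) <;> exact hmem _

/-- A vertex with at most three neighbours does not have four distinct ones. -/
theorem eq_of_adj_of_ncard_neighborSet_le_three {V : Type*} [Finite V] {G : SimpleGraph V} {v : V}
    (h : (G.neighborSet v).ncard ≤ 3) {p q r s : V}
    (hp : G.Adj v p) (hq : G.Adj v q) (hr : G.Adj v r) (hs : G.Adj v s) :
    p = q ∨ p = r ∨ p = s ∨ q = r ∨ q = s ∨ r = s := by
  classical
  by_contra! hne
  have hsub : (({p, q, r, s} : Finset V) : Set V) ⊆ G.neighborSet v := by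
    intro x hx
    simp only [Finset.coe_insert, Finset.coe_singleton, Set.mem_insert_iff,
      Set.mem_singleton_iff] at hx
    rcases hx with rfl | rfl | rfl | rfl <;> assumption
  have hle := Set.ncard_le_ncard hsub
  rw [Set.ncard_coe_finset] at hle
  have hcard : ({p, q, r, s} : Finset V).card = 4 :=
    Finset.card_eq_of_equiv_fin (Finset.equivFinOfCardEq (by simp [hne]))
  omega

/-- In a subcubic graph, a 4-cycle which misses the closed neighbourhood of a vertex `a` of a 4-cycle
is disjoint from the latter 4-cycle. -/
theorem IsFourCycleMissing.not_mem {V : Type*} [Finite V] {G : SimpleGraph V}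
    (hdeg : ∀ v, (G.neighborSet v).ncard ≤ 3) {a b c d p q r s : V}
    (hL : IsFourCycle G a b c d) (hC : IsFourCycleMissing G a p q r s) :
    ¬ (p = a ∨ p = b ∨ p = c ∨ p = d) := by
  have hp := hC.missing p (by simp)
  have hq := hC.missing q (by simp)
  have hs := hC.missing s (by simp)
  rintro (rfl | rfl | rfl | rfl)
  · exact hp.1 rfl
  · exact hp.2 hL.ab
  · rcases eq_of_adj_of_ncard_neighborSet_le_three (hdeg p) hL.bc.symm hL.cd hC.ab hC.da.symm with
      h | h | h | h | h | h
    · exact hL.bd h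
    · exact hq.2 (h ▸ hL.ab)
    · exact hs.2 (h ▸ hL.ab)
    · exact hq.2 (h ▸ hL.da.symm)
    · exact hs.2 (h ▸ hL.da.symm)
    · exact hC.bd h
  · exact hp.2 hL.da.symm

/-- Two vertex-disjoint 4-cycles which together miss at most one vertex of `G`. -/
structure DisjointFourCycles {V : Type*} (G : SimpleGraph V) (a b c d e f g h : V) : Prop where
  left : IsFourCycle G a b c d
  right : IsFourCycle G e f g h
  disjoint : ∀ x, (x = a ∨ x = b ∨ x = c ∨ x = d) → ¬ (x = e ∨ x = f ∨ x = g ∨ x = h)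
  eq_of_outside : ∀ x y,
    ¬ (x = a ∨ x = b ∨ x = c ∨ x = d ∨ x = e ∨ x = f ∨ x = g ∨ x = h) →
    ¬ (y = a ∨ y = b ∨ y = c ∨ y = d ∨ y = e ∨ y = f ∨ y = g ∨ y = h) → x = y

namespace DisjointFourCycles

variable {V : Type*} {G : SimpleGraph V} {a b c d e f g h : V}

theorem symm (H : DisjointFourCycles G a b c d e f g h) :
    DisjointFourCycles G e f g h a b c d :=
  ⟨H.right, H.left, fun x hx hx' => H.disjoint x hx' hx,
    fun x y hx hy => H.eq_of_outside x y (by tauto) (by tauto)⟩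

theorem rotate (H : DisjointFourCycles G a b c d e f g h) :
    DisjointFourCycles G b c d a e f g h :=
  ⟨H.left.rotate, H.right, fun x hx => H.disjoint x (by tauto),
    fun x y hx hy => H.eq_of_outside x y (by tauto) (by tauto)⟩

theorem exists_rotation_left (H : DisjointFourCycles G a b c d e f g h) {x : V}
    (hx : x = a ∨ x = b ∨ x = c ∨ x = d) :
    ∃ b' c' d', DisjointFourCycles G x b' c' d' e f g h ∧
      ∀ u, (u = x ∨ u = b' ∨ u = c' ∨ u = d') → (u = a ∨ u = b ∨ u = c ∨ u = d) := by
  rcases hx with rfl | rfl | rfl | rfl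
  · exact ⟨_, _, _, H, fun u hu => by clear H; tauto⟩
  · exact ⟨_, _, _, H.rotate, fun u hu => by clear H; tauto⟩
  · exact ⟨_, _, _, H.rotate.rotate, fun u hu => by clear H; tauto⟩
  · exact ⟨_, _, _, H.rotate.rotate.rotate, fun u hu => by clear H; tauto⟩

/-- If the first vertices of the two cycles are adjacent, then a 4-cycle which misses the closed
neighbourhood of one of them passes through a vertex `w` outside both cycles. -/
theorem exists_outside_adj (H : DisjointFourCycles G a b c d e f g h)
    (hdeg : ∀ v, (G.neighborSet v).ncard ≤ 3) [Finite V]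
    (hbad : ∀ v, ∃ p q r s, IsFourCycleMissing G v p q r s)
    (hae : G.Adj a e) :
    ∃ w, ¬ (w = a ∨ w = b ∨ w = c ∨ w = d ∨ w = e ∨ w = f ∨ w = g ∨ w = h) ∧
      G.Adj w f ∧ G.Adj w h := by
  obtain ⟨p, q, r, s, hC⟩ := hbad a
  obtain ⟨hL, hR, hdisj, hout⟩ := H
  have hne {p q r s} (hC : IsFourCycleMissing G a p q r s) :
      ¬ (p = a ∨ p = b ∨ p = c ∨ p = d ∨ p = e) := by
    have h₁ := hC.not_mem hdeg hL
    have h₂ : p ≠ e := fun e => (hC.missing p (by simp)).2 (e ▸ hae)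
    clear * - h₁ h₂
    tauto
  have key {p q r s} (hC : IsFourCycleMissing G a p q r s) (hp : ¬ (p = f ∨ p = g ∨ p = h)) :
      ∃ w, ¬ (w = a ∨ w = b ∨ w = c ∨ w = d ∨ w = e ∨ w = f ∨ w = g ∨ w = h) ∧
        G.Adj w f ∧ G.Adj w h := by
    have outside {x} (h₁ : ¬ (x = a ∨ x = b ∨ x = c ∨ x = d ∨ x = e))
        (h₂ : ¬ (x = f ∨ x = g ∨ x = h)) :
        ¬ (x = a ∨ x = b ∨ x = c ∨ x = d ∨ x = e ∨ x = f ∨ x = g ∨ x = h) := by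
      clear * - h₁ h₂
      tauto
    have hpo := outside (hne hC) hp
    have hq : q = f ∨ q = g ∨ q = h := by
      by_contra hq
      exact hC.ab.ne (hout p q hpo (outside (hne hC.rotate) hq))
    have hr : r = f ∨ r = g ∨ r = h := by
      by_contra hr
      exact hC.ac (hout p r hpo (outside (hne hC.rotate.rotate) hr))
    have hs : s = f ∨ s = g ∨ s = h := by
      by_contra hs
      exact hC.da.ne (hout s p (outside (hne hC.rotate.rotate.rotate) hs) hpo)
    refine ⟨p, hpo, ?_⟩
    have hpe : p ≠ e := fun h => hne hC (by simp [h])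
    have hf := fun h₁ h₂ => eq_of_adj_of_ncard_neighborSet_le_three (hdeg f)
      (p := e) (q := g) (r := h) (s := p) hR.ab.symm hR.bc h₁ h₂
    have hh := fun h₁ h₂ => eq_of_adj_of_ncard_neighborSet_le_three (hdeg h)
      (p := e) (q := g) (r := f) (s := p) hR.da hR.cd.symm h₁ h₂
    have := hC.ab
    have := hC.bc
    have := hC.cd
    have := hC.da
    have := hC.bd
    have := hC.bc.ne
    have := hC.cd.ne
    have := hR.bd
    have := hR.ac
    have := hR.ab.ne
    have := hR.da.ne
    have := G.adj_comm p q
    have := G.adj_comm p s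
    have := G.adj_comm q r
    have := G.adj_comm r s
    clear hne outside hout hdisj hpo hbad hdeg hC hR hL
    grind
  by_cases hp : p = f ∨ p = g ∨ p = h
  · by_cases hq : q = f ∨ q = g ∨ q = h
    · by_cases hr : r = f ∨ r = g ∨ r = h
      · refine key hC.rotate.rotate.rotate fun hs => ?_
        have := hC.ab.ne
        have := hC.bc.ne
        have := hC.cd.ne
        have := hC.da.ne
        have := hC.ac
        have := hC.bd
        clear hne key hout hdisj hbad hdeg hC hR hL
        grind
      · exact key hC.rotate.rotate hr
    · exact key hC.rotate hq
  · exact key hC hp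

/-- If each closed neighbourhood misses a 4-cycle, there is no edge between the two cycles. -/
theorem not_adj [Finite V] (H : DisjointFourCycles G a b c d e f g h)
    (hdeg : ∀ v, (G.neighborSet v).ncard ≤ 3)
    (hbad : ∀ v, ∃ p q r s, IsFourCycleMissing G v p q r s)
    {x y : V} (hx : x = a ∨ x = b ∨ x = c ∨ x = d) (hy : y = e ∨ y = f ∨ y = g ∨ y = h) :
    ¬ G.Adj x y := by
  intro hxy
  obtain ⟨b', c', d', H₁, -⟩ := H.exists_rotation_left hx
  obtain ⟨f', g', h', H₂, -⟩ := H₁.symm.exists_rotation_left hy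
  obtain ⟨w, hw, hwb, hwd⟩ := H₂.exists_outside_adj hdeg hbad hxy.symm
  obtain ⟨w', hw', hwf, hwh⟩ := H₂.symm.exists_outside_adj hdeg hbad hxy
  obtain rfl : w = w' := H₂.eq_of_outside w w' hw (by clear * - hw'; tauto)
  have hdisj := H₂.disjoint
  rcases eq_of_adj_of_ncard_neighborSet_le_three (hdeg w) hwb hwd hwf hwh with
    e | e | e | e | e | e
  · exact H₂.right.bd e
  · exact hdisj _ (.inr (.inl rfl)) (.inr (.inl e.symm))
  · exact hdisj _ (.inr (.inr (.inr rfl))) (.inr (.inl e.symm))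
  · exact hdisj _ (.inr (.inl rfl)) (.inr (.inr (.inr e.symm)))
  · exact hdisj _ (.inr (.inr (.inr rfl))) (.inr (.inr (.inr e.symm)))
  · exact H₂.left.bd e

/-- A connected graph has an edge leaving the first of the two cycles. -/
theorem exists_adj_outside (H : DisjointFourCycles G a b c d e f g h) (hG : G.Connected) :
    ∃ x y, (x = a ∨ x = b ∨ x = c ∨ x = d) ∧ ¬ (y = a ∨ y = b ∨ y = c ∨ y = d) ∧ G.Adj x y := by
  obtain ⟨p⟩ := hG.preconnected a e
  obtain ⟨D, -, h₁, h₂⟩ := p.exists_boundary_dart {x | x = a ∨ x = b ∨ x = c ∨ x = d}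
    (Or.inl rfl) (fun he => H.disjoint e he (Or.inl rfl))
  exact ⟨D.fst, D.snd, h₁, h₂, D.adj⟩

/-- If each closed neighbourhood misses a 4-cycle and there is no edge between the two cycles, then
no vertex is adjacent to both cycles. -/
theorem not_adj_of_not_adj (H : DisjointFourCycles G a b c d e f g h)
    (hbad : ∀ v, ∃ p q r s, IsFourCycleMissing G v p q r s)
    (hno : ∀ x y, (x = a ∨ x = b ∨ x = c ∨ x = d) → (y = e ∨ y = f ∨ y = g ∨ y = h) → ¬ G.Adj x y)
    {w : V} (hw : ¬ (w = a ∨ w = b ∨ w = c ∨ w = d ∨ w = e ∨ w = f ∨ w = g ∨ w = h))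
    (hwa : G.Adj w a) : ¬ G.Adj w e := by
  intro hwe
  obtain ⟨p, q, r, s, hC⟩ := hbad w
  have hmem {x} (hx : x = p ∨ x = q ∨ x = r ∨ x = s) :
      (x = b ∨ x = c ∨ x = d) ∨ (x = f ∨ x = g ∨ x = h) := by
    obtain ⟨h₁, h₂⟩ := hC.missing x hx
    have h₃ : x ≠ a := fun e => h₂ (e ▸ hwa)
    have h₄ : x ≠ e := fun e => h₂ (e ▸ hwe)
    by_contra h₅
    exact h₁ (H.eq_of_outside x w (by clear * - h₃ h₄ h₅; tauto) hw)
  have hp := hmem (x := p) (by simp)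
  have hq := hmem (x := q) (by simp)
  have hr := hmem (x := r) (by simp)
  have hs := hmem (x := s) (by simp)
  have stepL {x y} (hx : x = b ∨ x = c ∨ x = d)
      (hy : (y = b ∨ y = c ∨ y = d) ∨ (y = f ∨ y = g ∨ y = h)) (hxy : G.Adj x y) :
      y = b ∨ y = c ∨ y = d :=
    hy.resolve_right fun hy => hno x y (.inr hx) (.inr hy) hxy
  have stepR {x y} (hx : x = f ∨ x = g ∨ x = h)
      (hy : (y = b ∨ y = c ∨ y = d) ∨ (y = f ∨ y = g ∨ y = h)) (hxy : G.Adj x y) :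
      y = f ∨ y = g ∨ y = h :=
    hy.resolve_left fun hy => hno y x (.inr hy) (.inr hx) hxy.symm
  have pigeon {u v w : V} (hp : p = u ∨ p = v ∨ p = w) (hq : q = u ∨ q = v ∨ q = w)
      (hr : r = u ∨ r = v ∨ r = w) (hs : s = u ∨ s = v ∨ s = w) : False := by
    have := hC.ab.ne
    have := hC.bc.ne
    have := hC.cd.ne
    have := hC.da.ne
    have := hC.ac
    have := hC.bd
    clear stepL stepR hmem hbad hno H hC hw
    grind
  rcases hp with hp | hp
  · have hq := stepL hp hq hC.ab
    have hr := stepL hq hr hC.bc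
    exact pigeon hp hq hr (stepL hr hs hC.cd)
  · have hq := stepR hp hq hC.ab
    have hr := stepR hq hr hC.bc
    exact pigeon hp hq hr (stepR hr hs hC.cd)

end DisjointFourCycles

/-- If `n ≤ 9` and `G` is a connected subcubic `n`-vertex graph that is not a `𝒢₄`-graph,
then `ι(G, C₄) ≤ 1`. -/
theorem stmt7 {V : Type*} [Fintype V] (G : SimpleGraph V)
    (hn : Fintype.card V ≤ 9) (hG : G.Connected)
    (hdeg : ∀ v, (G.neighborSet v).ncard ≤ 3)
    (hE : ∀ H ∈ calG4, ¬ Nonempty (G ≃g H.2)) :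
    isolNum C4 G ≤ 1 := by
  by_contra! hlt
  have hbad := exists_fourCycle_of_one_lt_isolNum hlt
  obtain ⟨v⟩ := hG.nonempty
  obtain ⟨a, b, c, d, hC⟩ := hbad v
  have hL := hC.toIsFourCycle
  obtain ⟨e, f, g, h, hR⟩ := hbad a
  have he := hR.not_mem hdeg hL
  have hf := hR.rotate.not_mem hdeg hL
  have hg := hR.rotate.rotate.not_mem hdeg hL
  have hh := hR.rotate.rotate.rotate.not_mem hdeg hL
  have H : DisjointFourCycles G a b c d e f g h := by
    refine ⟨hL, hR.toIsFourCycle, ?_, fun x y hx hy => ?_⟩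
    · rintro x hx (rfl | rfl | rfl | rfl)
      exacts [he hx, hf hx, hg hx, hh hx]
    · by_contra hxy
      have hnodup : [x, y, e, f, g, h, a, b, c, d].Nodup := by
        simp only [not_or] at he hf hg hh hx hy
        simp [he, hf, hg, hh, hx, hy, hxy, hL.ab.ne, hL.bc.ne, hL.cd.ne, hL.da.ne.symm, hL.ac,
          hL.bd, hR.ab.ne, hR.bc.ne, hR.cd.ne, hR.da.ne.symm, hR.ac, hR.bd]
      have hlen := hnodup.length_le_card
      simp only [List.length_cons, List.length_nil] at hlen
      omega
  have hno := fun x y hx hy => H.not_adj hdeg hbad (x := x) (y := y) hx hy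
  obtain ⟨x, w, hx, hw, hxw⟩ := H.exists_adj_outside hG
  obtain ⟨y, z, hy, hz, hyz⟩ := H.symm.exists_adj_outside hG
  have hw' : ¬ (w = e ∨ w = f ∨ w = g ∨ w = h) := fun hw' => hno x w hx hw' hxw
  have hz' : ¬ (z = a ∨ z = b ∨ z = c ∨ z = d) := fun hz' => hno z y hz' hy hyz.symm
  obtain rfl : w = z := H.eq_of_outside w z (by clear * - hw hw'; tauto)
    (by clear * - hz hz'; tauto)
  obtain ⟨b', c', d', H₁, h₁⟩ := H.exists_rotation_left hx
  obtain ⟨f', g', h', H₂, h₂⟩ := H₁.symm.exists_rotation_left hy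
  refine H₂.not_adj_of_not_adj hbad (fun _ _ => H₂.not_adj hdeg hbad) ?_ hyz.symm hxw.symm
  have h₁ := h₁ w
  have h₂ := h₂ w
  clear * - h₁ h₂ hw hz
  tauto
end

section
/- If G is a connected graph on n vertices with maximum degree at most 3 that is not a G_4-graph, then ι(G, C_4) ≤ ⌊n/5⌋. -/
open SimpleGraph

namespace SquareIsolation

variable {V : Type*} {G : SimpleGraph V}

/-- `a b c d` are, in this order, the vertices of a 4-cycle of `G`. -/
def Sq (G : SimpleGraph V) (a b c d : V) : Prop :=
  G.Adj a b ∧ G.Adj b c ∧ G.Adj c d ∧ G.Adj d a ∧ a ≠ c ∧ b ≠ d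

/-- `v` lies in the closed neighbourhood of `D`. -/
def Hit (G : SimpleGraph V) (D : Finset V) (v : V) : Prop :=
  ∃ u ∈ D, u = v ∨ G.Adj u v

/-- Some vertex of the quadruple lies in the closed neighbourhood of `D`. -/
def Hit4 (G : SimpleGraph V) (D : Finset V) (a b c d : V) : Prop :=
  Hit G D a ∨ Hit G D b ∨ Hit G D c ∨ Hit G D d

/-- `N[D]` meets every 4-cycle inside `W`. -/
def Kills (G : SimpleGraph V) (W D : Finset V) : Prop :=
  ∀ a ∈ W, ∀ b ∈ W, ∀ c ∈ W, ∀ d ∈ W, Sq G a b c d → Hit4 G D a b c d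

/-- `W` induces a (pre)connected subgraph: every proper nonempty part of `W` has an edge to
the rest of `W`. -/
def Conn (G : SimpleGraph V) (W : Finset V) : Prop :=
  ∀ A ⊆ W, A.Nonempty → A ≠ W → ∃ a ∈ A, ∃ b ∈ W, b ∉ A ∧ G.Adj a b

/-- The 4-cycles inside `W` can be met by few closed neighbourhoods. -/
def Good (G : SimpleGraph V) (W : Finset V) : Prop :=
  ∃ D : Finset V, 5 * D.card ≤ W.card ∧ Kills G W D

/-- `𝓤` is a set of components of `G[R]` spanned by a 4-cycle, and `N[D]` meets
all 4-cycles in the rest of `R`. -/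
structure Decomp (G : SimpleGraph V) (R : Finset V) (𝓤 : Finset (Finset V)) (D : Finset V) :
    Prop where
  sub : ∀ U ∈ 𝓤, U ⊆ R
  card_eq : ∀ U ∈ 𝓤, U.card = 4
  sq : ∀ U ∈ 𝓤, ∃ a ∈ U, ∃ b ∈ U, ∃ c ∈ U, ∃ d ∈ U, Sq G a b c d
  closed : ∀ U ∈ 𝓤, ∀ u ∈ U, ∀ v ∈ R, G.Adj u v → v ∈ U
  disj : ∀ U ∈ 𝓤, ∀ U' ∈ 𝓤, U ≠ U' → Disjoint U U'
  card_le : 4 * 𝓤.card + 5 * D.card ≤ R.card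
  kills : ∀ a ∈ R, ∀ b ∈ R, ∀ c ∈ R, ∀ d ∈ R, Sq G a b c d →
    (∃ U ∈ 𝓤, a ∈ U) ∨ Hit4 G D a b c d

lemma Sq.rotate {a b c d : V} (h : Sq G a b c d) : Sq G b c d a :=
  ⟨h.2.1, h.2.2.1, h.2.2.2.1, h.1, h.2.2.2.2.2, h.2.2.2.2.1.symm⟩

lemma Sq.reverse {a b c d : V} (h : Sq G a b c d) : Sq G a d c b :=
  ⟨h.2.2.2.1.symm, h.2.2.1.symm, h.2.1.symm, h.1.symm, h.2.2.2.2.1, h.2.2.2.2.2.symm⟩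

lemma Hit.mono {D D' : Finset V} (h : D ⊆ D') {v : V} : Hit G D v → Hit G D' v :=
  fun ⟨u, hu, hv⟩ => ⟨u, h hu, hv⟩

lemma Hit4.mono {D D' : Finset V} (h : D ⊆ D') {a b c d : V} :
    Hit4 G D a b c d → Hit4 G D' a b c d :=
  Or.imp (Hit.mono h) (Or.imp (Hit.mono h) (Or.imp (Hit.mono h) (Hit.mono h)))

lemma Hit4.unrotate {D : Finset V} {a b c d : V} (h : Hit4 G D b c d a) : Hit4 G D a b c d := by
  unfold Hit4 at *; tauto

lemma hit4_of_mem {a b c d v : V} {D : Finset V} (hv : v = a ∨ v = b ∨ v = c ∨ v = d)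
    (h : Hit G D v) : Hit4 G D a b c d := by
  unfold Hit4
  rcases hv with rfl | rfl | rfl | rfl <;> tauto

/-- Three distinct neighbours of a vertex exhaust its neighbourhood. -/
def Subcubic (G : SimpleGraph V) : Prop :=
  ∀ v x y z w, G.Adj v x → G.Adj v y → G.Adj v z → G.Adj v w → x ≠ y → x ≠ z → y ≠ z →
    w = x ∨ w = y ∨ w = z

/-- The graph on six vertices made of two 4-cycles sharing the edge `a₂ b₂`. -/
structure Domino (G : SimpleGraph V) (a₁ a₂ a₃ b₁ b₂ b₃ : V) : Prop where
  a₁₂ : G.Adj a₁ a₂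
  a₂₃ : G.Adj a₂ a₃
  b₁₂ : G.Adj b₁ b₂
  b₂₃ : G.Adj b₂ b₃
  ab₁ : G.Adj a₁ b₁
  ab₂ : G.Adj a₂ b₂
  ab₃ : G.Adj a₃ b₃
  nodup : [a₁, a₂, a₃, b₁, b₂, b₃].Nodup

lemma Domino.flip {a₁ a₂ a₃ b₁ b₂ b₃ : V} (h : Domino G a₁ a₂ a₃ b₁ b₂ b₃) :
    Domino G b₁ b₂ b₃ a₁ a₂ a₃ :=
  ⟨h.b₁₂, h.b₂₃, h.a₁₂, h.a₂₃, h.ab₁.symm, h.ab₂.symm, h.ab₃.symm, by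
    have := h.nodup; simp at *; grind⟩

lemma Domino.mirror {a₁ a₂ a₃ b₁ b₂ b₃ : V} (h : Domino G a₁ a₂ a₃ b₁ b₂ b₃) :
    Domino G a₃ a₂ a₁ b₃ b₂ b₁ :=
  ⟨h.a₂₃.symm, h.a₁₂.symm, h.b₂₃.symm, h.b₁₂.symm, h.ab₃, h.ab₂, h.ab₁, by
    have := h.nodup; simp at *; grind⟩

/-- A vertex with two dominated neighbours lies on no undominated 4-cycle. -/
lemma Sq.hit4_of_adj (hG : Subcubic G) {p q r s x y : V} {D : Finset V} (h : Sq G p q r s)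
    (hx : G.Adj p x) (hy : G.Adj p y) (hxy : x ≠ y) (hxD : Hit G D x) (hyD : Hit G D y) :
    Hit4 G D p q r s := by
  unfold Hit4
  by_contra! hn
  have h1 : q ≠ x := by rintro rfl; exact hn.2.1 hxD
  have h2 : q ≠ y := by rintro rfl; exact hn.2.1 hyD
  have h3 : s ≠ x := by rintro rfl; exact hn.2.2.2 hxD
  have h4 : s ≠ y := by rintro rfl; exact hn.2.2.2 hyD
  rcases hG p x y q s hx hy h.1 h.2.2.2.1.symm hxy h1.symm h2.symm with h' | h' | h'
  · exact h3 h'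
  · exact h4 h'
  · exact h.2.2.2.2.2 h'.symm

lemma isolNum_C4_le_card {D : Finset V}
    (h : ∀ a b c d, Sq G a b c d → Hit4 G D a b c d) : isolNum C4 G ≤ D.card := by
  refine Nat.sInf_le ⟨(D : Set V), Set.ncard_coe_finset D, ?_⟩
  rintro ⟨f, hf⟩
  have hadj : ∀ i j, C4.Adj i j → G.Adj (f i : V) (f j) := fun i j hij => hf hij
  have hne : ∀ i j, i ≠ j → (f i : V) ≠ f j := fun i j hij e => hij (f.injective (Subtype.ext e))
  have hout : ∀ i, ¬ Hit G D (f i) := by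
    rintro i ⟨u, hu, huv⟩
    refine (f i).2 ?_
    rcases huv with huv | huv
    · exact Or.inl (huv ▸ hu)
    · exact Or.inr ⟨u, hu, huv⟩
  have hC : C4.Adj 0 1 ∧ C4.Adj 1 2 ∧ C4.Adj 2 3 ∧ C4.Adj 3 0 := by
    unfold C4; decide
  rcases h (f 0) (f 1) (f 2) (f 3) ⟨hadj _ _ hC.1, hadj _ _ hC.2.1, hadj _ _ hC.2.2.1,
    hadj _ _ hC.2.2.2, hne _ _ (by decide), hne _ _ (by decide)⟩ with h | h | h | h
  all_goals exact hout _ h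

lemma subcubic_of_ncard [Fintype V] (hdeg : ∀ v, (G.neighborSet v).ncard ≤ 3) : Subcubic G := by
  classical
  intro v x y z w hx hy hz hw hxy hxz hyz
  by_contra! hn
  have hsub : (({x, y, z, w} : Finset V) : Set V) ⊆ G.neighborSet v := by
    intro u hu
    simp only [Finset.coe_insert, Finset.coe_singleton, Set.mem_insert_iff,
      Set.mem_singleton_iff] at hu
    rcases hu with rfl | rfl | rfl | rfl <;> assumption
  have h1 := Set.ncard_le_ncard hsub (Set.toFinite _)
  have h2 : ({x, y, z, w} : Finset V).card = 4 := by grind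
  rw [Set.ncard_coe_finset, h2] at h1
  have := hdeg v
  omega

lemma conn_univ [Fintype V] (hG : G.Connected) : Conn G Finset.univ := by
  intro A _ hA hne
  by_contra! hno
  obtain ⟨a, ha⟩ := hA
  refine hne (Finset.eq_univ_of_forall fun v => ?_)
  obtain ⟨p⟩ := hG.preconnected a v
  induction p with
  | nil => exact ha
  | @cons u v w huv p ih =>
    refine ih ?_
    by_contra hv
    exact hno u ha v (Finset.mem_univ _) hv huv

/-- A graph on four vertices with a spanning 4-cycle is `C₄`, the diamond or `K₄`. -/
lemma Sq.exists_iso [Fintype V] {a b c d : V} (h : Sq G a b c d) (hcard : Fintype.card V = 4) :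
    ∃ H ∈ calG4, Nonempty (G ≃g H.2) := by
  classical
  have of_bij : ∀ {a b c d : V}, Sq G a b c d → ∀ K : SimpleGraph (Fin 4),
      K.Adj 0 1 → K.Adj 1 2 → K.Adj 2 3 → K.Adj 3 0 → (K.Adj 0 2 ↔ G.Adj a c) →
      (K.Adj 1 3 ↔ G.Adj b d) → Nonempty (G ≃g K) := by
    intro a b c d h K h01 h12 h23 h30 h02 h13
    obtain ⟨g1, g2, g3, g4, hac, hbd⟩ := h
    have e1 := g1.ne; have e2 := g2.ne; have e3 := g3.ne; have e4 := g4.ne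
    have hinj : Function.Injective ![a, b, c, d] := by
      intro i j hij
      fin_cases i <;> fin_cases j <;> simp_all
    have hbij : Function.Bijective ![a, b, c, d] :=
      (Fintype.bijective_iff_injective_and_card _).2 ⟨hinj, by simp [hcard]⟩
    refine ⟨RelIso.symm ⟨Equiv.ofBijective _ hbij, ?_⟩⟩
    intro i j
    have s01 := h01.symm; have s12 := h12.symm; have s23 := h23.symm; have s30 := h30.symm
    have t1 := g1.symm; have t2 := g2.symm; have t3 := g3.symm; have t4 := g4.symm
    have s02 := K.adj_comm 0 2; have s13 := K.adj_comm 1 3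
    have t02 := G.adj_comm a c; have t13 := G.adj_comm b d
    fin_cases i <;> fin_cases j <;> simp_all
  by_cases hac : G.Adj a c
  · by_cases hbd : G.Adj b d
    · exact ⟨⟨4, K4⟩, by simp [calG4], of_bij h K4 (by simp [K4]) (by simp [K4]) (by simp [K4])
        (by simp [K4]) (by simp [K4, hac]) (by simp [K4, hbd])⟩
    · exact ⟨⟨4, diamondGraph⟩, by simp [calG4], of_bij h _ (by simp [diamondGraph])
        (by simp [diamondGraph]) (by simp [diamondGraph]) (by simp [diamondGraph])
        (by simp [diamondGraph, hac]) (by simp [diamondGraph, hbd])⟩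
  · by_cases hbd : G.Adj b d
    · have hca : ¬ G.Adj c a := fun h => hac h.symm
      exact ⟨⟨4, diamondGraph⟩, by simp [calG4], of_bij h.rotate _ (by simp [diamondGraph])
        (by simp [diamondGraph]) (by simp [diamondGraph]) (by simp [diamondGraph])
        (by simp [diamondGraph, hbd]) (by simp [diamondGraph, hca])⟩
    · have hC : C4.Adj 0 1 ∧ C4.Adj 1 2 ∧ C4.Adj 2 3 ∧ C4.Adj 3 0 ∧ ¬ C4.Adj 0 2 ∧
          ¬ C4.Adj 1 3 := by
        unfold C4; decide
      exact ⟨⟨4, C4⟩, by simp [calG4], of_bij h _ hC.1 hC.2.1 hC.2.2.1 hC.2.2.2.1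
        (iff_of_false hC.2.2.2.2.1 hac) (iff_of_false hC.2.2.2.2.2 hbd)⟩

variable [DecidableEq V]

lemma Sq.card_eq {a b c d : V} (h : Sq G a b c d) : ({a, b, c, d} : Finset V).card = 4 := by
  obtain ⟨h1, h2, h3, h4, h5, h6⟩ := h
  have := h1.ne; have := h2.ne; have := h3.ne; have := h4.ne
  grind

/-- A 4-cycle inside a 4-element set uses all of its elements. -/
lemma Sq.mem_of_card {a b c d : V} (h : Sq G a b c d) {U : Finset V} (hU : U.card = 4)
    (ha : a ∈ U) (hb : b ∈ U) (hc : c ∈ U) (hd : d ∈ U) {v : V} (hv : v ∈ U) :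
    v = a ∨ v = b ∨ v = c ∨ v = d := by
  have hs : ({a, b, c, d} : Finset V) ⊆ U := by
    intro x hx; simp only [Finset.mem_insert, Finset.mem_singleton] at hx
    rcases hx with rfl | rfl | rfl | rfl <;> assumption
  have := Finset.eq_of_subset_of_card_le hs (by rw [h.card_eq, hU])
  rw [← this] at hv
  simpa using hv

lemma exists_decomp (R : Finset V)
    (IH : ∀ S : Finset V, S ⊆ R → Conn G S → S.card ≠ 4 → Good G S) :
    ∃ 𝓤 D, Decomp G R 𝓤 D := by
  induction R using Finset.strongInduction with
  | H R ih =>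
  by_cases hR : Conn G R
  · by_cases h4 : R.card = 4
    · by_cases hs : ∃ a ∈ R, ∃ b ∈ R, ∃ c ∈ R, ∃ d ∈ R, Sq G a b c d
      · refine ⟨{R}, ∅, by simp, by simpa using h4, by simpa using hs, ?_, by simp, by simp [h4], ?_⟩
        · simp only [Finset.mem_singleton, forall_eq]
          exact fun u _ v hv _ => hv
        · intro a ha b hb c hc d hd _
          exact Or.inl ⟨R, by simp, ha⟩
      · refine ⟨∅, ∅, by simp, by simp, by simp, by simp, by simp, by simp, ?_⟩
        intro a ha b hb c hc d hd h
        exact (hs ⟨a, ha, b, hb, c, hc, d, hd, h⟩).elim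
    · obtain ⟨D, hD, hk⟩ := IH R (Finset.Subset.refl _) hR h4
      exact ⟨∅, D, by simp, by simp, by simp, by simp, by simp, by simpa using hD,
        fun a ha b hb c hc d hd h => Or.inr (hk a ha b hb c hc d hd h)⟩
  · unfold Conn at hR
    push Not at hR
    obtain ⟨A, hAR, hA, hne, hcut⟩ := hR
    have hA' : A ⊂ R := lt_of_le_of_ne hAR hne
    have hB' : R \ A ⊂ R := Finset.sdiff_ssubset hAR hA
    obtain ⟨𝓤₁, D₁, h₁⟩ := ih A hA' (fun S hS => IH S (hS.trans hAR))
    obtain ⟨𝓤₂, D₂, h₂⟩ := ih (R \ A) hB' (fun S hS => IH S (hS.trans hB'.1))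
    refine ⟨𝓤₁ ∪ 𝓤₂, D₁ ∪ D₂, ?_, ?_, ?_, ?_, ?_, ?_, ?_⟩
    · intro U hU
      rcases Finset.mem_union.1 hU with h | h
      · exact (h₁.sub U h).trans hAR
      · exact (h₂.sub U h).trans hB'.1
    · intro U hU
      rcases Finset.mem_union.1 hU with h | h
      · exact h₁.card_eq U h
      · exact h₂.card_eq U h
    · intro U hU
      rcases Finset.mem_union.1 hU with h | h
      · exact h₁.sq U h
      · exact h₂.sq U h
    · intro U hU u hu v hv huv
      rcases Finset.mem_union.1 hU with h | h
      · refine h₁.closed U h u hu v ?_ huv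
        by_contra hvA
        exact hcut u (h₁.sub U h hu) v hv hvA huv
      · refine h₂.closed U h u hu v ?_ huv
        have huB := Finset.mem_sdiff.1 (h₂.sub U h hu)
        refine Finset.mem_sdiff.2 ⟨hv, fun hvA => ?_⟩
        exact hcut v hvA u huB.1 huB.2 huv.symm
    · have hAB : Disjoint A (R \ A) := Finset.disjoint_sdiff
      intro U hU U' hU' hne
      rcases Finset.mem_union.1 hU with h | h <;> rcases Finset.mem_union.1 hU' with h' | h'
      · exact h₁.disj U h U' h' hne
      · exact Finset.disjoint_of_subset_left (h₁.sub U h)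
          (Finset.disjoint_of_subset_right (h₂.sub U' h') hAB)
      · exact Finset.disjoint_of_subset_left (h₂.sub U h)
          (Finset.disjoint_of_subset_right (h₁.sub U' h') hAB.symm)
      · exact h₂.disj U h U' h' hne
    · have := h₁.card_le
      have := h₂.card_le
      have := Finset.card_union_le 𝓤₁ 𝓤₂
      have := Finset.card_union_le D₁ D₂
      have := Finset.card_sdiff_add_card_eq_card hAR
      omega
    · intro a ha b hb c hc d hd h
      have hstep : ∀ x ∈ R, ∀ y ∈ R, G.Adj x y → (x ∈ A ↔ y ∈ A) := by
        intro x hx y hy hxy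
        constructor <;> intro hm <;> by_contra hn
        · exact hcut x hm y hy hn hxy
        · exact hcut y hm x hx hn hxy.symm
      have hab := hstep a ha b hb h.1
      have hbc := hstep b hb c hc h.2.1
      have hcd := hstep c hc d hd h.2.2.1
      by_cases haA : a ∈ A
      · rcases h₁.kills a haA b (hab.1 haA) c (hbc.1 (hab.1 haA)) d
          (hcd.1 (hbc.1 (hab.1 haA))) h with ⟨U, hU, haU⟩ | hh
        · exact Or.inl ⟨U, Finset.mem_union_left _ hU, haU⟩
        · exact Or.inr (hh.mono Finset.subset_union_left)
      · have hbA : b ∉ A := fun hx => haA (hab.2 hx)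
        have hcA : c ∉ A := fun hx => hbA (hbc.2 hx)
        have hdA : d ∉ A := fun hx => hcA (hcd.2 hx)
        rcases h₂.kills a (Finset.mem_sdiff.2 ⟨ha, haA⟩) b (Finset.mem_sdiff.2 ⟨hb, hbA⟩)
          c (Finset.mem_sdiff.2 ⟨hc, hcA⟩) d (Finset.mem_sdiff.2 ⟨hd, hdA⟩) h with
          ⟨U, hU, haU⟩ | hh
        · exact Or.inl ⟨U, Finset.mem_union_right _ hU, haU⟩
        · exact Or.inr (hh.mono Finset.subset_union_right)

/-- Deal separately with the 4-cycles that meet `Y` and those that avoid it. -/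
lemma kills_of_sdiff {W Y D : Finset V}
    (hY : ∀ a ∈ Y, ∀ b ∈ W, ∀ c ∈ W, ∀ d ∈ W, Sq G a b c d → Hit4 G D a b c d)
    (hR : Kills G (W \ Y) D) : Kills G W D := by
  intro a ha b hb c hc d hd hs
  by_cases haY : a ∈ Y
  · exact hY a haY b hb c hc d hd hs
  by_cases hbY : b ∈ Y
  · exact (hY b hbY c hc d hd a ha hs.rotate).unrotate
  by_cases hcY : c ∈ Y
  · exact (hY c hcY d hd a ha b hb hs.rotate.rotate).unrotate.unrotate
  by_cases hdY : d ∈ Y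
  · exact (hY d hdY a ha b hb c hc hs.rotate.rotate.rotate).unrotate.unrotate.unrotate
  exact hR a (Finset.mem_sdiff.2 ⟨ha, haY⟩) b (Finset.mem_sdiff.2 ⟨hb, hbY⟩)
    c (Finset.mem_sdiff.2 ⟨hc, hcY⟩) d (Finset.mem_sdiff.2 ⟨hd, hdY⟩) hs

lemma Decomp.good {W Y : Finset V} {𝓤 : Finset (Finset V)} {D₀ : Finset V}
    (h : Decomp G (W \ Y) 𝓤 D₀) (hYW : Y ⊆ W) (D₁ : Finset V)
    (hU : ∀ U ∈ 𝓤, ∃ u ∈ U, Hit G D₁ u)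
    (hY : ∀ a ∈ Y, ∀ b ∈ W, ∀ c ∈ W, ∀ d ∈ W, Sq G a b c d → Hit4 G D₁ a b c d)
    (hcard : 5 * D₁.card ≤ Y.card + 4 * 𝓤.card) : Good G W := by
  refine ⟨D₀ ∪ D₁, ?_, ?_⟩
  · have := h.card_le
    have := Finset.card_union_le D₀ D₁
    have := Finset.card_sdiff_add_card_eq_card hYW
    omega
  · have hmono : ∀ {a b c d}, Hit4 G D₁ a b c d → Hit4 G (D₀ ∪ D₁) a b c d :=
      fun h => h.mono Finset.subset_union_right
    refine kills_of_sdiff (Y := Y)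
      (fun a ha b hb c hc d hd hs => hmono (hY a ha b hb c hc d hd hs)) ?_
    intro a ha' b hb' c hc' d hd' hs
    rcases h.kills a ha' b hb' c hc' d hd' hs with ⟨U, hUU, haU⟩ | hh
    · have hbU := h.closed U hUU a haU b hb' hs.1
      have hcU := h.closed U hUU b hbU c hc' hs.2.1
      have hdU := h.closed U hUU c hcU d hd' hs.2.2.1
      obtain ⟨u, hu, hit⟩ := hU U hUU
      exact hmono (hit4_of_mem (hs.mem_of_card (h.card_eq U hUU) haU hbU hcU hdU hu) hit)
    · exact hh.mono Finset.subset_union_left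

/-- Every 4-cycle component left after deleting `Y` sends an edge to `Y`. -/
lemma Decomp.exists_adj {W Y : Finset V} {𝓤 : Finset (Finset V)} {D₀ : Finset V}
    (h : Decomp G (W \ Y) 𝓤 D₀) (hW : Conn G W) (hYW : Y ⊆ W) (hne : Y.Nonempty)
    {U : Finset V} (hU : U ∈ 𝓤) : ∃ y ∈ Y, ∃ u ∈ U, G.Adj y u := by
  have hsub := h.sub U hU
  have hn : U.Nonempty := by
    rw [← Finset.card_pos, h.card_eq U hU]; norm_num
  have hUW : U ≠ W := by
    rintro rfl
    obtain ⟨y, hy⟩ := hne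
    exact (Finset.mem_sdiff.1 (hsub (hYW hy))).2 hy
  obtain ⟨u, hu, y, hy, hyU, huy⟩ := hW U (hsub.trans Finset.sdiff_subset) hn hUW
  refine ⟨y, ?_, u, hu, huy.symm⟩
  by_contra hyY
  exact hyU (h.closed U hU u hu y (Finset.mem_sdiff.2 ⟨hy, hyY⟩) huy)

/-- A set `T ⊆ Y` of at most `𝓤.card` vertices whose closed neighbourhood meets each `U ∈ 𝓤`. -/
lemma Decomp.exists_transversal {W Y : Finset V} {𝓤 : Finset (Finset V)} {D₀ : Finset V}
    (h : Decomp G (W \ Y) 𝓤 D₀) (hW : Conn G W) (hYW : Y ⊆ W) (hne : Y.Nonempty) :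
    ∃ T ⊆ Y, T.card ≤ 𝓤.card ∧ (∀ U ∈ 𝓤, ∃ y ∈ T, ∃ u ∈ U, G.Adj y u) ∧
      ∀ y ∈ T, ∃ U ∈ 𝓤, ∃ u ∈ U, G.Adj y u := by
  have : Nonempty V := ⟨hne.choose⟩
  choose! f hf using fun U (hU : U ∈ 𝓤) => h.exists_adj hW hYW hne hU
  refine ⟨𝓤.image f, ?_, Finset.card_image_le, ?_, ?_⟩
  · intro y hy
    obtain ⟨U, hU, rfl⟩ := Finset.mem_image.1 hy
    exact (hf U hU).1
  · exact fun U hU => ⟨f U, Finset.mem_image_of_mem f hU, (hf U hU).2⟩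
  · intro y hy
    obtain ⟨U, hU, rfl⟩ := Finset.mem_image.1 hy
    exact ⟨U, hU, (hf U hU).2⟩

lemma good_of_K23 (hG : Subcubic G) {W : Finset V} (hW : Conn G W)
    (IH : ∀ S : Finset V, S ⊂ W → Conn G S → S.card ≠ 4 → Good G S)
    {a c b d e : V} (ha : a ∈ W) (hc : c ∈ W) (hb : b ∈ W) (hd : d ∈ W) (he : e ∈ W)
    (hab : G.Adj a b) (had : G.Adj a d) (hae : G.Adj a e)
    (hcb : G.Adj c b) (hcd : G.Adj c d) (hce : G.Adj c e)
    (hac : a ≠ c) (hbd : b ≠ d) (hbe : b ≠ e) (hde : d ≠ e) : Good G W := by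
  set Y : Finset V := {a, c, b, d, e} with hYdef
  have hYW : Y ⊆ W := by simp [Finset.insert_subset_iff, *]
  have hYne : Y.Nonempty := ⟨a, by simp [hYdef]⟩
  have hYc : Y.card = 5 := by
    have := hab.ne; have := had.ne; have := hae.ne
    have := hcb.ne; have := hcd.ne; have := hce.ne
    grind
  obtain ⟨𝓤, D₀, h⟩ := exists_decomp (G := G) (W \ Y)
    (fun S hS => IH S (hS.trans_ssubset (Finset.sdiff_ssubset hYW hYne)))
  obtain ⟨T, hTY, hTc, hTU, -⟩ := h.exists_transversal hW hYW hYne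
  have hTc5 := Finset.card_le_card hTY
  have key : ∀ D : Finset V, (∃ y ∈ Y, y ∈ D) →
      ∀ p ∈ Y, ∀ q ∈ W, ∀ r ∈ W, ∀ s ∈ W, Sq G p q r s → Hit4 G D p q r s := by
    rintro D ⟨y, hyY, hyD⟩ p hp q hq r hr s hs hsq
    have hself : ∀ {v}, y = v → Hit G D v := fun h => ⟨y, hyD, Or.inl h⟩
    have hadj : ∀ {v}, G.Adj y v → Hit G D v := fun h => ⟨y, hyD, Or.inr h⟩
    have hbig : (Hit G D a ∧ Hit G D c) ∨ (Hit G D b ∧ Hit G D d ∧ Hit G D e) := by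
      simp only [hYdef, Finset.mem_insert, Finset.mem_singleton] at hyY
      rcases hyY with rfl | rfl | rfl | rfl | rfl
      · exact Or.inr ⟨hadj hab, hadj had, hadj hae⟩
      · exact Or.inr ⟨hadj hcb, hadj hcd, hadj hce⟩
      · exact Or.inl ⟨hadj hab.symm, hadj hcb.symm⟩
      · exact Or.inl ⟨hadj had.symm, hadj hcd.symm⟩
      · exact Or.inl ⟨hadj hae.symm, hadj hce.symm⟩
    simp only [hYdef, Finset.mem_insert, Finset.mem_singleton] at hp
    rcases hbig with ⟨h1, h2⟩ | ⟨h1, h2, h3⟩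
    · rcases hp with rfl | rfl | rfl | rfl | rfl
      · exact Or.inl h1
      · exact Or.inl h2
      · exact hsq.hit4_of_adj hG hab.symm hcb.symm hac h1 h2
      · exact hsq.hit4_of_adj hG had.symm hcd.symm hac h1 h2
      · exact hsq.hit4_of_adj hG hae.symm hce.symm hac h1 h2
    · rcases hp with rfl | rfl | rfl | rfl | rfl
      · exact hsq.hit4_of_adj hG hab had hbd h1 h2
      · exact hsq.hit4_of_adj hG hcb hcd hbd h1 h2
      · exact Or.inl h1
      · exact Or.inl h2
      · exact Or.inl h3
  rcases T.eq_empty_or_nonempty with rfl | ⟨y, hy⟩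
  · refine h.good hYW {a} ?_ (key _ ⟨a, by simp [hYdef], by simp⟩) (by simp [hYc])
    intro U hU
    obtain ⟨y, hy, -⟩ := hTU U hU
    simp at hy
  · refine h.good hYW T ?_ (key _ ⟨y, hTY hy, hy⟩) (by omega)
    intro U hU
    obtain ⟨y, hy, u, hu, hyu⟩ := hTU U hU
    exact ⟨u, hu, y, hy, Or.inr hyu⟩

lemma Domino.hit4_of_middle (hG : Subcubic G) {a₁ a₂ a₃ b₁ b₂ b₃ : V}
    (h : Domino G a₁ a₂ a₃ b₁ b₂ b₃) {D : Finset V} (hD : a₂ ∈ D) {p q r s : V}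
    (hp : p ∈ ({a₁, a₂, a₃, b₁, b₂, b₃} : Finset V)) (hs : Sq G p q r s) :
    Hit4 G D p q r s := by
  have hne := h.nodup
  simp only [List.nodup_cons, List.mem_cons, List.not_mem_nil, not_or] at hne
  have h1 : Hit G D a₁ := ⟨a₂, hD, Or.inr h.a₁₂.symm⟩
  have h2 : Hit G D a₂ := ⟨a₂, hD, Or.inl rfl⟩
  have h3 : Hit G D a₃ := ⟨a₂, hD, Or.inr h.a₂₃⟩
  have h4 : Hit G D b₂ := ⟨a₂, hD, Or.inr h.ab₂⟩
  simp only [Finset.mem_insert, Finset.mem_singleton] at hp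
  rcases hp with rfl | rfl | rfl | rfl | rfl | rfl
  · exact Or.inl h1
  · exact Or.inl h2
  · exact Or.inl h3
  · exact hs.hit4_of_adj hG h.ab₁.symm h.b₁₂ (by tauto) h1 h4
  · exact Or.inl h4
  · exact hs.hit4_of_adj hG h.ab₃.symm h.b₂₃.symm (by tauto) h3 h4

lemma Domino.hit4_of_ends (hG : Subcubic G) {a₁ a₂ a₃ b₁ b₂ b₃ : V}
    (h : Domino G a₁ a₂ a₃ b₁ b₂ b₃) {D : Finset V} (hl : a₁ ∈ D ∨ b₁ ∈ D)
    (hr : a₃ ∈ D ∨ b₃ ∈ D) {p q r s : V}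
    (hp : p ∈ ({a₁, a₂, a₃, b₁, b₂, b₃} : Finset V)) (hs : Sq G p q r s) :
    Hit4 G D p q r s := by
  have hne := h.nodup
  simp only [List.nodup_cons, List.mem_cons, List.not_mem_nil, not_or] at hne
  have h1 : Hit G D a₁ := by
    rcases hl with hl | hl
    · exact ⟨_, hl, Or.inl rfl⟩
    · exact ⟨_, hl, Or.inr h.ab₁.symm⟩
  have h2 : Hit G D b₁ := by
    rcases hl with hl | hl
    · exact ⟨_, hl, Or.inr h.ab₁⟩
    · exact ⟨_, hl, Or.inl rfl⟩
  have h3 : Hit G D a₃ := by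
    rcases hr with hr | hr
    · exact ⟨_, hr, Or.inl rfl⟩
    · exact ⟨_, hr, Or.inr h.ab₃.symm⟩
  have h4 : Hit G D b₃ := by
    rcases hr with hr | hr
    · exact ⟨_, hr, Or.inr h.ab₃⟩
    · exact ⟨_, hr, Or.inl rfl⟩
  simp only [Finset.mem_insert, Finset.mem_singleton] at hp
  rcases hp with rfl | rfl | rfl | rfl | rfl | rfl
  · exact Or.inl h1
  · exact hs.hit4_of_adj hG h.a₁₂.symm h.a₂₃ (by tauto) h1 h3
  · exact Or.inl h3
  · exact Or.inl h2
  · exact hs.hit4_of_adj hG h.b₁₂.symm h.b₂₃ (by tauto) h2 h4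
  · exact Or.inl h4

/-- The case of a domino where both ends of one of its short sides, and these only, are used to
reach the 4-cycle components of the rest. -/
lemma Domino.good_of_side (hG : Subcubic G) {W : Finset V} (hW : Conn G W)
    (IH : ∀ S : Finset V, S ⊂ W → Conn G S → S.card ≠ 4 → Good G S)
    {a₁ a₂ a₃ b₁ b₂ b₃ : V} (h : Domino G a₁ a₂ a₃ b₁ b₂ b₃)
    (hYW : ({a₁, a₂, a₃, b₁, b₂, b₃} : Finset V) ⊆ W)
    {𝓤 : Finset (Finset V)} {D₀ : Finset V}
    (hD : Decomp G (W \ {a₁, a₂, a₃, b₁, b₂, b₃}) 𝓤 D₀) (hcard : 2 ≤ 𝓤.card)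
    (hcov : ∀ U ∈ 𝓤, ∃ u ∈ U, G.Adj a₁ u ∨ G.Adj b₁ u)
    {U₁ U₂ : Finset V} (hU₁ : U₁ ∈ 𝓤) (hU₂ : U₂ ∈ 𝓤) {u₁ u₂ : V} (hu₁ : u₁ ∈ U₁)
    (hu₂ : u₂ ∈ U₂) (hau : G.Adj a₁ u₁) (hbu : G.Adj b₁ u₂) : Good G W := by
  set Y : Finset V := {a₁, a₂, a₃, b₁, b₂, b₃} with hY
  have hne := h.nodup
  simp only [List.nodup_cons, List.mem_cons, List.not_mem_nil, not_or] at hne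
  have hYc : Y.card = 6 := by
    have : Y = [a₁, a₂, a₃, b₁, b₂, b₃].toFinset := by simp [hY]
    rw [this, List.toFinset_card_of_nodup h.nodup]; rfl
  have hUY : ∀ {U}, U ∈ 𝓤 → ∀ {u}, u ∈ U → u ∈ W ∧ u ∉ Y := fun hU u hu =>
    Finset.mem_sdiff.1 (hD.sub _ hU hu)
  have hnb1 : ∀ w, G.Adj a₁ w → w = a₂ ∨ w = b₁ ∨ w = u₁ := fun w hw =>
    hG a₁ a₂ b₁ u₁ w h.a₁₂ h.ab₁ hau hw (by tauto)
      (by rintro rfl; exact (hUY hU₁ hu₁).2 (by simp [hY]))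
      (by rintro rfl; exact (hUY hU₁ hu₁).2 (by simp [hY]))
  have hnb2 : ∀ w, G.Adj b₁ w → w = b₂ ∨ w = a₁ ∨ w = u₂ := fun w hw =>
    hG b₁ b₂ a₁ u₂ w h.b₁₂ h.ab₁.symm hbu hw (by tauto)
      (by rintro rfl; exact (hUY hU₂ hu₂).2 (by simp [hY]))
      (by rintro rfl; exact (hUY hU₂ hu₂).2 (by simp [hY]))
  have hnb3 : ∀ w, G.Adj a₂ w → w = a₁ ∨ w = a₃ ∨ w = b₂ := fun w hw =>
    hG a₂ a₁ a₃ b₂ w h.a₁₂.symm h.a₂₃ h.ab₂ hw (by tauto) (by tauto) (by tauto)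
  have hnb4 : ∀ w, G.Adj b₂ w → w = b₁ ∨ w = b₃ ∨ w = a₂ := fun w hw =>
    hG b₂ b₁ b₃ a₂ w h.b₁₂.symm h.b₂₃ h.ab₂.symm hw (by tauto) (by tauto) (by tauto)
  have hall : ∀ U ∈ 𝓤, U = U₁ ∨ U = U₂ := by
    intro U hU
    obtain ⟨u, hu, hu'⟩ := hcov U hU
    by_contra! hn
    rcases hu' with hu' | hu'
    · rcases hnb1 u hu' with rfl | rfl | rfl
      · exact (hUY hU hu).2 (by simp [hY])
      · exact (hUY hU hu).2 (by simp [hY])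
      · exact Finset.disjoint_left.1 (hD.disj U hU U₁ hU₁ hn.1) hu hu₁
    · rcases hnb2 u hu' with rfl | rfl | rfl
      · exact (hUY hU hu).2 (by simp [hY])
      · exact (hUY hU hu).2 (by simp [hY])
      · exact Finset.disjoint_left.1 (hD.disj U hU U₂ hU₂ hn.2) hu hu₂
  have h12 : U₁ ≠ U₂ := by
    rintro rfl
    have : 𝓤 ⊆ {U₁} := fun U hU => by simpa using hall U hU
    have := Finset.card_le_card this
    simp at this
    omega
  by_cases hcase : ∃ x, (x = a₃ ∨ x = b₃) ∧ ∃ v, (v ∈ U₁ ∨ v ∈ U₂) ∧ G.Adj x v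
  · obtain ⟨x, hx, v, hv, hxv⟩ := hcase
    have hpair : ∀ x y : V, 5 * ({x, y} : Finset V).card ≤ Y.card + 4 * 𝓤.card := fun x y => by
      have := Finset.card_le_two (a := x) (b := y)
      omega
    have hxD : ∀ y : V, a₃ ∈ ({x, y} : Finset V) ∨ b₃ ∈ ({x, y} : Finset V) := by
      intro y
      rcases hx with rfl | rfl <;> simp
    rcases hv with hv | hv
    · refine hD.good hYW {x, b₁} ?_ (fun p hp q _ r _ s _ hs =>
        h.hit4_of_ends hG (by simp) (hxD _) hp hs) (hpair _ _)
      intro U hU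
      rcases hall U hU with rfl | rfl
      · exact ⟨v, hv, x, by simp, Or.inr hxv⟩
      · exact ⟨u₂, hu₂, b₁, by simp, Or.inr hbu⟩
    · refine hD.good hYW {x, a₁} ?_ (fun p hp q _ r _ s _ hs =>
        h.hit4_of_ends hG (by simp) (hxD _) hp hs) (hpair _ _)
      intro U hU
      rcases hall U hU with rfl | rfl
      · exact ⟨u₁, hu₁, a₁, by simp, Or.inr hau⟩
      · exact ⟨v, hv, x, by simp, Or.inr hxv⟩
  · set Z : Finset V := {a₁, b₁, b₂, a₂} ∪ (U₁ ∪ U₂) with hZ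
    have memZ : ∀ {z}, z ∈ Z ↔
        (z = a₁ ∨ z = b₁ ∨ z = b₂ ∨ z = a₂) ∨ z ∈ U₁ ∨ z ∈ U₂ := by
      intro z; simp [hZ, or_assoc]
    have memY : ∀ {z}, z ∈ Y ↔ z = a₁ ∨ z = a₂ ∨ z = a₃ ∨ z = b₁ ∨ z = b₂ ∨ z = b₃ := by
      intro z; simp [hY]
    have hZW : Z ⊆ W := by
      intro z hz
      rcases memZ.1 hz with hz | hz | hz
      · exact hYW (by rcases hz with rfl | rfl | rfl | rfl <;> simp [hY])
      · exact (hUY hU₁ hz).1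
      · exact (hUY hU₂ hz).1
    have hZc : Z.card = 12 := by
      have e1 : ({a₁, b₁, b₂, a₂} : Finset V).card = 4 :=
        Sq.card_eq (G := G) ⟨h.ab₁, h.b₁₂, h.ab₂.symm, h.a₁₂.symm, hne.1.2.2.2.1, by tauto⟩
      rw [hZ, Finset.card_union_of_disjoint, Finset.card_union_of_disjoint
        (hD.disj U₁ hU₁ U₂ hU₂ h12), hD.card_eq U₁ hU₁, hD.card_eq U₂ hU₂, e1]
      rw [Finset.disjoint_left]
      intro z hz hz'
      have hzY : z ∈ Y := by
        simp only [Finset.mem_insert, Finset.mem_singleton] at hz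
        rcases hz with rfl | rfl | rfl | rfl <;> simp [hY]
      rcases Finset.mem_union.1 hz' with h' | h'
      · exact (hUY hU₁ h').2 hzY
      · exact (hUY hU₂ h').2 hzY
    have hWc := Finset.card_sdiff_add_card_eq_card hZW
    have hout : ∀ z ∈ Z, ∀ v ∈ W, v ∉ Z → G.Adj z v → v = a₃ ∨ v = b₃ := by
      intro z hz v hvW hvZ hzv
      by_contra! hn
      rw [memZ] at hvZ
      have hno : ¬ (v = a₁ ∨ v = b₁ ∨ v = b₂ ∨ v = a₂ ∨ v = u₁ ∨ v = u₂ ∨ v = a₃ ∨ v = b₃) := by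
        rintro (e | e | e | e | e | e | e | e)
        on_goal 7 => exact hn.1 e
        on_goal 7 => exact hn.2 e
        all_goals exact hvZ (by simp [e, hu₁, hu₂])
      have hvY : v ∈ W \ Y := Finset.mem_sdiff.2 ⟨hvW, fun hv => hno (by
        rcases memY.1 hv with e | e | e | e | e | e <;> simp [e])⟩
      rcases memZ.1 hz with (rfl | rfl | rfl | rfl) | hz | hz
      · exact hno (by rcases hnb1 v hzv with e | e | e <;> simp [e])
      · exact hno (by rcases hnb2 v hzv with e | e | e <;> simp [e])
      · exact hno (by rcases hnb4 v hzv with e | e | e <;> simp [e])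
      · exact hno (by rcases hnb3 v hzv with e | e | e <;> simp [e])
      · exact hvZ (Or.inr (Or.inl (hD.closed U₁ hU₁ z hz v hvY hzv)))
      · exact hvZ (Or.inr (Or.inr (hD.closed U₂ hU₂ z hz v hvY hzv)))
    have ha₃Z : a₃ ∉ Z := by
      rw [memZ]; rintro (h' | h' | h')
      · clear * - hne h'; grind
      · exact (hUY hU₁ h').2 (by simp [hY])
      · exact (hUY hU₂ h').2 (by simp [hY])
    have hb₃Z : b₃ ∉ Z := by
      rw [memZ]; rintro (h' | h' | h')
      · clear * - hne h'; grind
      · exact (hUY hU₁ h').2 (by simp [hY])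
      · exact (hUY hU₂ h').2 (by simp [hY])
    have ha₃ : a₃ ∈ W \ Z := Finset.mem_sdiff.2 ⟨hYW (by simp [hY]), ha₃Z⟩
    have hb₃ : b₃ ∈ W \ Z := Finset.mem_sdiff.2 ⟨hYW (by simp [hY]), hb₃Z⟩
    have hconn' : ∀ B ⊆ W \ Z, B.Nonempty → a₃ ∉ B → b₃ ∉ B →
        ∃ a ∈ B, ∃ b ∈ W \ Z, b ∉ B ∧ G.Adj a b := by
      intro B hB hBn ha hb
      have hBW : B ≠ W := fun e => ha (e ▸ hYW (by simp [hY]))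
      obtain ⟨x, hx, y, hy, hyB, hxy⟩ := hW B (hB.trans Finset.sdiff_subset) hBn hBW
      refine ⟨x, hx, y, Finset.mem_sdiff.2 ⟨hy, fun hyZ => ?_⟩, hyB, hxy⟩
      have hx' := Finset.mem_sdiff.1 (hB hx)
      rcases hout y hyZ x hx'.1 hx'.2 hxy.symm with rfl | rfl
      · exact ha hx
      · exact hb hx
    have hconn : Conn G (W \ Z) := by
      intro A hA hAn hAne
      by_contra! hno
      have hiff : a₃ ∈ A ↔ b₃ ∈ A := by
        constructor <;> intro hm <;> by_contra hn
        · exact hno _ hm _ hb₃ hn h.ab₃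
        · exact hno _ hm _ ha₃ hn h.ab₃.symm
      by_cases haA : a₃ ∈ A
      · obtain ⟨x, hx, y, hy, hyB, hxy⟩ := hconn' ((W \ Z) \ A) Finset.sdiff_subset
          (Finset.sdiff_nonempty.2 fun hle => hAne (hA.antisymm hle))
          (fun hm => (Finset.mem_sdiff.1 hm).2 haA)
          (fun hm => (Finset.mem_sdiff.1 hm).2 (hiff.1 haA))
        have hx' := Finset.mem_sdiff.1 hx
        refine hno y ?_ x hx'.1 hx'.2 hxy.symm
        by_contra hyA
        exact hyB (Finset.mem_sdiff.2 ⟨hy, hyA⟩)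
      · obtain ⟨x, hx, y, hy, hyB, hxy⟩ := hconn' A hA hAn haA (fun hm => haA (hiff.2 hm))
        exact hno x hx y hy hyB hxy
    have hhit : ∀ D : Finset V, {a₁, b₁} ⊆ D →
        ∀ p ∈ Z, ∀ q ∈ W, ∀ r ∈ W, ∀ s ∈ W, Sq G p q r s → Hit4 G D p q r s := by
      intro D hDs p hp q hq r hr s hs' hs
      have ha : a₁ ∈ D := hDs (by simp)
      have hb : b₁ ∈ D := hDs (by simp)
      have hfour : ∀ z, z = a₁ ∨ z = b₁ ∨ z = b₂ ∨ z = a₂ → Hit G D z := by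
        rintro z (rfl | rfl | rfl | rfl)
        · exact ⟨_, ha, Or.inl rfl⟩
        · exact ⟨_, hb, Or.inl rfl⟩
        · exact ⟨_, hb, Or.inr h.b₁₂⟩
        · exact ⟨_, ha, Or.inr h.a₁₂⟩
      have hstay : ∀ U ∈ 𝓤, (U = U₁ ∨ U = U₂) → ∀ x ∈ U, ∀ y ∈ W, G.Adj x y →
          y ∈ U ∨ Hit G D y := by
        intro U hU hU' x hx y hy hxy
        by_cases hyY : y ∈ Y
        · right
          refine hfour y ?_
          have : ¬ (y = a₃ ∨ y = b₃) := fun hy3 =>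
            hcase ⟨y, hy3, x, by rcases hU' with rfl | rfl <;> simp [hx], hxy.symm⟩
          rw [memY] at hyY
          clear * - this hyY
          tauto
        · exact Or.inl (hD.closed U hU x hx y (Finset.mem_sdiff.2 ⟨hy, hyY⟩) hxy)
      have hU : ∀ U ∈ 𝓤, (U = U₁ ∨ U = U₂) → (∃ u ∈ U, Hit G D u) → p ∈ U →
          Hit4 G D p q r s := by
        rintro U hU hU' ⟨u, hu, huD⟩ hpU
        rcases hstay U hU hU' p hpU q hq hs.1 with hqU | hh
        · rcases hstay U hU hU' q hqU r hr hs.2.1 with hrU | hh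
          · rcases hstay U hU hU' p hpU s hs' hs.2.2.2.1.symm with hsU | hh
            · exact hit4_of_mem (hs.mem_of_card (hD.card_eq U hU) hpU hqU hrU hsU hu) huD
            · exact Or.inr (Or.inr (Or.inr hh))
          · exact Or.inr (Or.inr (Or.inl hh))
        · exact Or.inr (Or.inl hh)
      rcases memZ.1 hp with hp | hp | hp
      · exact Or.inl (hfour p hp)
      · exact hU U₁ hU₁ (Or.inl rfl) ⟨u₁, hu₁, a₁, ha, Or.inr hau⟩ hp
      · exact hU U₂ hU₂ (Or.inr rfl) ⟨u₂, hu₂, b₁, hb, Or.inr hbu⟩ hp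
    by_cases hc4 : (W \ Z).card = 4
    · refine ⟨{a₁, b₁, a₃}, ?_, kills_of_sdiff (hhit _ ?_) ?_⟩
      · have := Finset.card_le_three (a := a₁) (b := b₁) (c := a₃)
        omega
      · intro z hz; rcases Finset.mem_insert.1 hz with e | e <;> simp_all only [
          Finset.mem_insert, Finset.mem_singleton, true_or, or_true]
      · intro a ha b hb c hc d hd hs
        exact hit4_of_mem (hs.mem_of_card hc4 ha hb hc hd ha₃) ⟨a₃, by simp, Or.inl rfl⟩
    · have hlt : W \ Z ⊂ W := Finset.sdiff_ssubset hZW ⟨a₁, memZ.2 (by simp)⟩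
      obtain ⟨D, hDc, hDk⟩ := IH _ hlt hconn hc4
      refine ⟨{a₁, b₁} ∪ D, ?_, kills_of_sdiff (hhit _ Finset.subset_union_left) ?_⟩
      · have := Finset.card_le_two (a := a₁) (b := b₁)
        have := Finset.card_union_le {a₁, b₁} D
        omega
      · intro a ha b hb c hc d hd hs
        exact (hDk a ha b hb c hc d hd hs).mono Finset.subset_union_right

lemma Domino.good (hG : Subcubic G) {W : Finset V} (hW : Conn G W)
    (IH : ∀ S : Finset V, S ⊂ W → Conn G S → S.card ≠ 4 → Good G S)
    {a₁ a₂ a₃ b₁ b₂ b₃ : V} (h : Domino G a₁ a₂ a₃ b₁ b₂ b₃)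
    (hYW : ({a₁, a₂, a₃, b₁, b₂, b₃} : Finset V) ⊆ W) : Good G W := by
  set Y : Finset V := {a₁, a₂, a₃, b₁, b₂, b₃} with hY
  have memY : ∀ {z}, z ∈ Y ↔ z = a₁ ∨ z = a₂ ∨ z = a₃ ∨ z = b₁ ∨ z = b₂ ∨ z = b₃ := by
    intro z; simp [hY]
  have hYc : Y.card = 6 := by
    have : Y = [a₁, a₂, a₃, b₁, b₂, b₃].toFinset := by simp [hY]
    rw [this, List.toFinset_card_of_nodup h.nodup]; rfl
  have hYne : Y.Nonempty := ⟨a₁, by simp [hY]⟩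
  obtain ⟨𝓤, D₀, hD⟩ := exists_decomp (G := G) (W \ Y)
    (fun S hS => IH S (hS.trans_ssubset (Finset.sdiff_ssubset hYW hYne)))
  obtain ⟨T, hTY, hTc, hTU, hTex⟩ := hD.exists_transversal hW hYW hYne
  have hTc6 := Finset.card_le_card hTY
  have hTU' : ∀ D, T ⊆ D → ∀ U ∈ 𝓤, ∃ u ∈ U, Hit G D u := by
    intro D hTD U hU
    obtain ⟨y, hy, u, hu, hyu⟩ := hTU U hU
    exact ⟨u, hu, y, hTD hy, Or.inr hyu⟩
  by_cases h1 : T.card ≤ 1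
  · refine hD.good hYW (insert a₂ T) (hTU' _ (Finset.subset_insert _ _))
      (fun p hp q _ r _ s _ hs => h.hit4_of_middle hG (Finset.mem_insert_self _ _) hp hs) ?_
    have := Finset.card_insert_le a₂ T
    omega
  by_cases h2 : a₂ ∈ T
  · exact hD.good hYW T (hTU' _ (Finset.Subset.refl _))
      (fun p hp q _ r _ s _ hs => h.hit4_of_middle hG h2 hp hs) (by omega)
  by_cases h3 : b₂ ∈ T
  · refine hD.good hYW T (hTU' _ (Finset.Subset.refl _))
      (fun p hp q _ r _ s _ hs => h.flip.hit4_of_middle hG h3 ?_ hs) (by omega)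
    rcases memY.1 hp with rfl | rfl | rfl | rfl | rfl | rfl <;> simp
  by_cases hl : a₁ ∈ T ∨ b₁ ∈ T
  · by_cases hr : a₃ ∈ T ∨ b₃ ∈ T
    · exact hD.good hYW T (hTU' _ (Finset.Subset.refl _))
        (fun p hp q _ r _ s _ hs => h.hit4_of_ends hG hl hr hp hs) (by omega)
    · have hT : ∀ y ∈ T, y = a₁ ∨ y = b₁ := by
        intro y hy
        have := memY.1 (hTY hy)
        rcases this with rfl | rfl | rfl | rfl | rfl | rfl <;> tauto
      obtain ⟨x, hx, y, hy, hxy⟩ := Finset.one_lt_card.1 (not_le.1 h1)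
      have ha : a₁ ∈ T := by
        rcases hT x hx with rfl | rfl
        · exact hx
        · rcases hT y hy with rfl | rfl <;> tauto
      have hb : b₁ ∈ T := by
        rcases hT x hx with rfl | rfl
        · rcases hT y hy with rfl | rfl <;> tauto
        · exact hx
      obtain ⟨U₁, hU₁, u₁, hu₁, hau⟩ := hTex _ ha
      obtain ⟨U₂, hU₂, u₂, hu₂, hbu⟩ := hTex _ hb
      refine h.good_of_side hG hW IH hYW hD (by omega) ?_ hU₁ hU₂ hu₁ hu₂ hau hbu
      intro U hU
      obtain ⟨y, hy, u, hu, hyu⟩ := hTU U hU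
      refine ⟨u, hu, ?_⟩
      rcases hT y hy with rfl | rfl <;> simp [hyu]
  · have hT : ∀ y ∈ T, y = a₃ ∨ y = b₃ := by
      intro y hy
      have := memY.1 (hTY hy)
      rcases this with rfl | rfl | rfl | rfl | rfl | rfl <;> tauto
    obtain ⟨x, hx, y, hy, hxy⟩ := Finset.one_lt_card.1 (not_le.1 h1)
    have ha : a₃ ∈ T := by
      rcases hT x hx with rfl | rfl
      · exact hx
      · rcases hT y hy with rfl | rfl <;> tauto
    have hb : b₃ ∈ T := by
      rcases hT x hx with rfl | rfl
      · rcases hT y hy with rfl | rfl <;> tauto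
      · exact hx
    obtain ⟨U₁, hU₁, u₁, hu₁, hau⟩ := hTex _ ha
    obtain ⟨U₂, hU₂, u₂, hu₂, hbu⟩ := hTex _ hb
    have hYm : Y = {a₃, a₂, a₁, b₃, b₂, b₁} := by
      rw [hY]; clear * -; grind
    rw [hYm] at hYW hD
    refine h.mirror.good_of_side hG hW IH hYW hD (by omega) ?_ hU₁ hU₂ hu₁ hu₂ hau hbu
    intro U hU
    obtain ⟨y, hy, u, hu, hyu⟩ := hTU U hU
    refine ⟨u, hu, ?_⟩
    rcases hT y hy with rfl | rfl <;> simp [hyu]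

/-- Two 4-cycles meeting in some but not all of their vertices span a `K_{2,3}` or a domino. -/
lemma good_of_edge_leaving (hG : Subcubic G) {W : Finset V} (hW : Conn G W)
    (IH : ∀ S : Finset V, S ⊂ W → Conn G S → S.card ≠ 4 → Good G S)
    {a b c d e f g : V} (ha : a ∈ W) (hb : b ∈ W) (hc : c ∈ W) (hd : d ∈ W)
    (he : e ∈ W) (hf : f ∈ W) (hs : Sq G a b c d) (ht : Sq G a e f g)
    (heb : e ≠ b) (hec : e ≠ c) (hed : e ≠ d) : Good G W := by
  have main : ∀ b d : V, b ∈ W → d ∈ W → Sq G a b c d → e ≠ b → e ≠ d → g = d → Good G W := by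
    rintro b g hb hg hs heb heg rfl
    obtain ⟨hab, hbc, hcg, hga, hac, hbg⟩ := hs
    obtain ⟨hae, hef, hfg, -, haf, -⟩ := ht
    by_cases hfc : f = c
    · subst hfc
      exact good_of_K23 hG hW IH ha hc hb hg he hab hga.symm hae hbc.symm hcg hef.symm haf
        hbg heb.symm heg.symm
    by_cases hfb : f = b
    · subst hfb
      rcases hG f a c e g hab.symm hbc hef.symm hfg hac hae.ne hec.symm with h | h | h
      · exact (hga.ne h).elim
      · exact (hcg.ne h.symm).elim
      · exact (heg h.symm).elim
    · refine Domino.good (a₁ := b) (a₂ := a) (a₃ := e) (b₁ := c) (b₂ := g) (b₃ := f) hG hW IH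
        ⟨hab.symm, hae, hcg, hfg.symm, hbc, hga.symm, hef, ?_⟩ ?_
      · have := hab.ne; have := hbc.ne; have := hcg.ne; have := hga.ne
        have := hae.ne; have := hef.ne; have := hfg.ne
        simp only [List.nodup_cons, List.mem_cons, List.not_mem_nil, not_or, List.nodup_nil,
          not_false_eq_true, and_true]
        grind
      · simp [Finset.insert_subset_iff, *]
  rcases hG a b d e g hs.1 hs.2.2.2.1.symm ht.1 ht.2.2.2.1.symm hs.2.2.2.2.2 heb.symm hed.symm
    with h | h | h
  · exact main d b hd hb hs.reverse hed heb h
  · exact main b d hb hd hs heb hed h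
  · exact (ht.2.2.2.2.2 h.symm).elim

/-- Two 4-cycles with a common vertex but different vertex sets. -/
lemma good_of_sq_inter (hG : Subcubic G) {W : Finset V} (hW : Conn G W)
    (IH : ∀ S : Finset V, S ⊂ W → Conn G S → S.card ≠ 4 → Good G S)
    {a b c d p q r : V} (ha : a ∈ W) (hb : b ∈ W) (hc : c ∈ W) (hd : d ∈ W)
    (hp : p ∈ W) (hq : q ∈ W) (hr : r ∈ W) (hs : Sq G a b c d) (ht : Sq G a p q r)
    (hne : ({a, p, q, r} : Finset V) ≠ {a, b, c, d}) : Good G W := by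
  by_cases h1 : p = b ∨ p = c ∨ p = d
  · by_cases h2 : q = b ∨ q = c ∨ q = d
    · by_cases h3 : r = b ∨ r = c ∨ r = d
      · refine (hne (Finset.eq_of_subset_of_card_le ?_ (by rw [hs.card_eq, ht.card_eq]))).elim
        intro x hx
        simp only [Finset.mem_insert, Finset.mem_singleton] at hx ⊢
        rcases hx with rfl | rfl | rfl | rfl
        · exact Or.inl rfl
        all_goals exact Or.inr (by assumption)
      · push Not at h3
        exact good_of_edge_leaving hG hW IH ha hb hc hd hr hq hs ht.reverse h3.1 h3.2.1 h3.2.2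
    · push Not at h2
      have ht' := ht.rotate
      have hqa : q ≠ a := ht.2.2.2.2.1.symm
      rcases h1 with rfl | rfl | rfl
      · exact good_of_edge_leaving hG hW IH hp hc hd ha hq hr hs.rotate ht' h2.2.1 h2.2.2 hqa
      · exact good_of_edge_leaving hG hW IH hp hd ha hb hq hr hs.rotate.rotate ht' h2.2.2 hqa h2.1
      · exact good_of_edge_leaving hG hW IH hp ha hb hc hq hr hs.rotate.rotate.rotate ht' hqa
          h2.1 h2.2.1
  · push Not at h1
    exact good_of_edge_leaving hG hW IH ha hb hc hd hp hq hs ht h1.1 h1.2.1 h1.2.2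

/-- The conclusion for one set, assuming that each 4-cycle in `W` is disjoint from all others. -/
lemma good_of_disjoint (hG : Subcubic G) {W : Finset V} (hW : Conn G W) (hW4 : W.card ≠ 4)
    (IH : ∀ S : Finset V, S ⊂ W → Conn G S → S.card ≠ 4 → Good G S)
    (hdis : ∀ a ∈ W, ∀ b ∈ W, ∀ c ∈ W, ∀ d ∈ W, ∀ p ∈ W, ∀ q ∈ W, ∀ r ∈ W, Sq G a b c d →
      Sq G a p q r → ({a, p, q, r} : Finset V) = {a, b, c, d}) : Good G W := by
  by_cases hsq : ∃ a ∈ W, ∃ b ∈ W, ∃ c ∈ W, ∃ d ∈ W, Sq G a b c d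
  swap
  · exact ⟨∅, by simp, fun a ha b hb c hc d hd h => (hsq ⟨a, ha, b, hb, c, hc, d, hd, h⟩).elim⟩
  have meet : ∀ a ∈ W, ∀ b ∈ W, ∀ c ∈ W, ∀ d ∈ W, Sq G a b c d →
      ∀ p ∈ ({a, b, c, d} : Finset V), ∀ q ∈ W, ∀ r ∈ W, ∀ s ∈ W, Sq G p q r s →
        ({p, q, r, s} : Finset V) = {a, b, c, d} := by
    intro a ha b hb c hc d hd h p hp q hq r hr s hs h'
    simp only [Finset.mem_insert, Finset.mem_singleton] at hp
    rcases hp with rfl | rfl | rfl | rfl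
    · exact hdis p ha b hb c hc d hd q hq r hr s hs h h'
    · rw [hdis p hb c hc d hd a ha q hq r hr s hs h.rotate h']; clear * -; grind
    · rw [hdis p hc d hd a ha b hb q hq r hr s hs h.rotate.rotate h']; clear * -; grind
    · rw [hdis p hd a ha b hb c hc q hq r hr s hs h.rotate.rotate.rotate h']; clear * -; grind
  have hitS : ∀ D : Finset V, ∀ a ∈ W, ∀ b ∈ W, ∀ c ∈ W, ∀ d ∈ W, Sq G a b c d →
      (∃ v ∈ ({a, b, c, d} : Finset V), Hit G D v) →
      ∀ p ∈ ({a, b, c, d} : Finset V), ∀ q ∈ W, ∀ r ∈ W, ∀ s ∈ W, Sq G p q r s →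
        Hit4 G D p q r s := by
    rintro D a ha b hb c hc d hd h ⟨v, hv, hvD⟩ p hp q hq r hr s hs h'
    rw [← meet a ha b hb c hc d hd h p hp q hq r hr s hs h'] at hv
    exact hit4_of_mem (by simpa using hv) hvD
  by_cases hadj : ∃ a ∈ W, ∃ b ∈ W, ∃ c ∈ W, ∃ d ∈ W, ∃ p ∈ W, ∃ q ∈ W, ∃ r ∈ W, ∃ s ∈ W,
      Sq G a b c d ∧ Sq G p q r s ∧ p ∉ ({a, b, c, d} : Finset V) ∧ G.Adj a p
  · obtain ⟨a, ha, b, hb, c, hc, d, hd, p, hp, q, hq, r, hr, s, hs, h, h', hpS, hap⟩ := hadj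
    have hSq := h
    have hPq := h'
    set S : Finset V := {a, b, c, d} with hS
    set P : Finset V := {p, q, r, s} with hP
    have hSW : S ⊆ W := by simp [Finset.insert_subset_iff, *]
    have hPW : P ⊆ W := by simp [Finset.insert_subset_iff, *]
    have hSc : S.card = 4 := h.card_eq
    have hPc : P.card = 4 := h'.card_eq
    have haS : a ∈ S := by simp [hS]
    have hpP : p ∈ P := by simp [hP]
    have hSP : Disjoint S P := by
      rw [Finset.disjoint_left]
      intro x hxS hxP
      refine hpS ?_
      have key : ∀ y ∈ W, ∀ z ∈ W, ∀ w ∈ W, Sq G x y z w →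
          ({x, y, z, w} : Finset V) = P → p ∈ S := by
        intro y hy z hz w hw hxq he
        rw [hS, ← meet a ha b hb c hc d hd h x hxS y hy z hz w hw hxq, he]
        exact hpP
      simp only [hP, Finset.mem_insert, Finset.mem_singleton] at hxP
      rcases hxP with rfl | rfl | rfl | rfl
      · exact key q hq r hr s hs h' rfl
      · exact key r hr s hs p hp h'.rotate (by rw [hP]; clear * -; grind)
      · exact key s hs p hp q hq h'.rotate.rotate (by rw [hP]; clear * -; grind)
      · exact key p hp q hq r hr h'.rotate.rotate.rotate (by rw [hP]; clear * -; grind)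
    have haP : a ∉ P := fun hx => Finset.disjoint_left.1 hSP haS hx
    set Y := S ∪ P with hY
    have hYW : Y ⊆ W := Finset.union_subset hSW hPW
    have hYc : Y.card = 8 := by rw [hY, Finset.card_union_of_disjoint hSP, hSc, hPc]
    have hYne : Y.Nonempty := ⟨a, Finset.mem_union_left _ haS⟩
    obtain ⟨𝓤, D₀, hD⟩ := exists_decomp (G := G) (W \ Y)
      (fun S hS => IH S (hS.trans_ssubset (Finset.sdiff_ssubset hYW hYne)))
    obtain ⟨T, hTY, hTc, hTU, hTex⟩ := hD.exists_transversal hW hYW hYne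
    have hTc8 := Finset.card_le_card hTY
    have good_of : ∀ D, T ⊆ D → (∃ v ∈ S, Hit G D v) → (∃ v ∈ P, Hit G D v) →
        5 * D.card ≤ Y.card + 4 * 𝓤.card → Good G W := by
      intro D hTD hDS hDP hDc
      refine hD.good hYW D ?_ ?_ hDc
      · intro U hU
        obtain ⟨y, hy, u, hu, hyu⟩ := hTU U hU
        exact ⟨u, hu, y, hTD hy, Or.inr hyu⟩
      · intro x hx
        rcases Finset.mem_union.1 hx with hx | hx
        · exact hitS D a ha b hb c hc d hd hSq hDS x hx
        · exact hitS D p hp q hq r hr s hs hPq hDP x hx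
    have haT : a ∉ T := by
      intro haT
      obtain ⟨U, hU, u, hu, hau⟩ := hTex a haT
      refine (Finset.mem_sdiff.1 (hD.sub U hU hu)).2 ?_
      rcases hG a b d p u hSq.1 hSq.2.2.2.1.symm hap hau hSq.2.2.2.2.2
        (by rintro rfl; exact hpS (by simp [hS])) (by rintro rfl; exact hpS (by simp [hS]))
        with rfl | rfl | rfl
      · exact Finset.mem_union_left _ (by simp [hS])
      · exact Finset.mem_union_left _ (by simp [hS])
      · exact Finset.mem_union_right _ hpP
    have hpT : p ∉ T := by
      intro hpT
      obtain ⟨U, hU, u, hu, hpu⟩ := hTex p hpT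
      refine (Finset.mem_sdiff.1 (hD.sub U hU hu)).2 ?_
      rcases hG p q s a u hPq.1 hPq.2.2.2.1.symm hap.symm hpu hPq.2.2.2.2.2
        (by rintro rfl; exact haP (by simp [hP])) (by rintro rfl; exact haP (by simp [hP]))
        with rfl | rfl | rfl
      · exact Finset.mem_union_right _ (by simp [hP])
      · exact Finset.mem_union_right _ (by simp [hP])
      · exact Finset.mem_union_left _ haS
    by_cases hTS : ∃ x ∈ T, x ∈ S
    · by_cases hTP : ∃ x ∈ T, x ∈ P
      · obtain ⟨x, hx, hxS⟩ := hTS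
        obtain ⟨y, hy, hyP⟩ := hTP
        exact good_of T (Finset.Subset.refl _) ⟨x, hxS, x, hx, Or.inl rfl⟩
          ⟨y, hyP, y, hy, Or.inl rfl⟩ (by omega)
      · have hsub : insert a T ⊆ S := by
          intro x hx
          rcases Finset.mem_insert.1 hx with rfl | hx
          · exact haS
          · exact (Finset.mem_union.1 (hTY hx)).resolve_right fun hxP => hTP ⟨x, hx, hxP⟩
        have := Finset.card_le_card hsub
        have := Finset.card_insert_of_notMem haT
        exact good_of (insert a T) (Finset.subset_insert _ _)
          ⟨a, haS, a, Finset.mem_insert_self _ _, Or.inl rfl⟩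
          ⟨p, hpP, a, Finset.mem_insert_self _ _, Or.inr hap⟩ (by omega)
    · have hsub : insert p T ⊆ P := by
        intro x hx
        rcases Finset.mem_insert.1 hx with rfl | hx
        · exact hpP
        · exact (Finset.mem_union.1 (hTY hx)).resolve_left fun hxS => hTS ⟨x, hx, hxS⟩
      have := Finset.card_le_card hsub
      have := Finset.card_insert_of_notMem hpT
      exact good_of (insert p T) (Finset.subset_insert _ _)
        ⟨a, haS, p, Finset.mem_insert_self _ _, Or.inr hap.symm⟩
        ⟨p, hpP, p, Finset.mem_insert_self _ _, Or.inl rfl⟩ (by omega)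
  · obtain ⟨a, ha, b, hb, c, hc, d, hd, h⟩ := hsq
    have hSc := h.card_eq
    have hSW : ({a, b, c, d} : Finset V) ⊆ W := by simp [Finset.insert_subset_iff, *]
    obtain ⟨y, hy, x, hx, hxS, hyx⟩ := hW {a, b, c, d} hSW (by simp)
      (by intro e; exact hW4 (by rw [← e, hSc]))
    have hYW : insert x ({a, b, c, d} : Finset V) ⊆ W := Finset.insert_subset hx hSW
    have hYne : (insert x ({a, b, c, d} : Finset V)).Nonempty := Finset.insert_nonempty _ _
    have hYc := Finset.card_insert_of_notMem hxS
    obtain ⟨𝓤, D₀, hD⟩ := exists_decomp (G := G) (W \ insert x {a, b, c, d})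
      (fun S hS => IH S (hS.trans_ssubset (Finset.sdiff_ssubset hYW hYne)))
    have hxD : Hit G {x} x := ⟨x, by simp, Or.inl rfl⟩
    refine hD.good hYW {x} ?_ ?_ (by rw [hYc, hSc]; simp)
    · intro U hU
      obtain ⟨z, hz, u, hu, hzu⟩ := hD.exists_adj hW hYW hYne hU
      rcases Finset.mem_insert.1 hz with rfl | hz
      · exact ⟨u, hu, z, by simp, Or.inr hzu⟩
      · exfalso
        have hUW : ∀ v ∈ U, v ∈ W ∧ v ∉ ({a, b, c, d} : Finset V) := fun v hv => by
          have := Finset.mem_sdiff.1 (hD.sub U hU hv)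
          exact ⟨this.1, fun h => this.2 (Finset.mem_insert_of_mem h)⟩
        obtain ⟨p, hp, q, hq, r, hr, s, hs, h'⟩ := hD.sq U hU
        have key : ∀ a ∈ W, ∀ b ∈ W, ∀ c ∈ W, ∀ d ∈ W, Sq G a b c d →
            u ∉ ({a, b, c, d} : Finset V) → G.Adj a u → False := by
          intro a ha b hb c hc d hd h huS hau
          have hp := (hUW p hp).1
          have hq := (hUW q hq).1
          have hr := (hUW r hr).1
          have hs := (hUW s hs).1
          rcases h'.mem_of_card (hD.card_eq U hU) ‹_› ‹_› ‹_› ‹_› hu with rfl | rfl | rfl | rfl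
          · exact hadj ⟨a, ha, b, hb, c, hc, d, hd, u, hp, q, hq, r, hr, s, hs, h, h', huS, hau⟩
          · exact hadj ⟨a, ha, b, hb, c, hc, d, hd, u, hq, r, hr, s, hs, p, hp, h, h'.rotate,
              huS, hau⟩
          · exact hadj ⟨a, ha, b, hb, c, hc, d, hd, u, hr, s, hs, p, hp, q, hq, h,
              h'.rotate.rotate, huS, hau⟩
          · exact hadj ⟨a, ha, b, hb, c, hc, d, hd, u, hs, p, hp, q, hq, r, hr, h,
              h'.rotate.rotate.rotate, huS, hau⟩
        have huS := (hUW u hu).2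
        simp only [Finset.mem_insert, Finset.mem_singleton] at hz
        rcases hz with rfl | rfl | rfl | rfl
        · exact key z ha b hb c hc d hd h huS hzu
        · exact key z hb c hc d hd a ha h.rotate (by clear * - huS; grind) hzu
        · exact key z hc d hd a ha b hb h.rotate.rotate (by clear * - huS; grind) hzu
        · exact key z hd a ha b hb c hc h.rotate.rotate.rotate (by clear * - huS; grind) hzu
    · intro p hp q hq r hr s hs h'
      rcases Finset.mem_insert.1 hp with rfl | hp
      · exact Or.inl hxD
      · exact hitS {x} a ha b hb c hc d hd h ⟨y, hy, x, by simp, Or.inr hyx.symm⟩ p hp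
          q hq r hr s hs h'

theorem good_of_conn (hG : Subcubic G) (W : Finset V) (hW : Conn G W) (hW4 : W.card ≠ 4) :
    Good G W := by
  induction W using Finset.strongInduction with
  | H W IH =>
  by_cases hdis : ∀ a ∈ W, ∀ b ∈ W, ∀ c ∈ W, ∀ d ∈ W, ∀ p ∈ W, ∀ q ∈ W, ∀ r ∈ W,
      Sq G a b c d → Sq G a p q r → ({a, p, q, r} : Finset V) = {a, b, c, d}
  · exact good_of_disjoint hG hW hW4 IH hdis
  · push Not at hdis
    obtain ⟨a, ha, b, hb, c, hc, d, hd, p, hp, q, hq, r, hr, hs, ht, hne⟩ := hdis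
    exact good_of_sq_inter hG hW IH ha hb hc hd hp hq hr hs ht hne

end SquareIsolation

/-- If `G` is a connected subcubic `n`-vertex graph that is not a `𝒢₄`-graph, then
`ι(G, C₄) ≤ ⌊n/5⌋`. -/
theorem stmt8 {V : Type*} [Fintype V] (G : SimpleGraph V) (hG : G.Connected)
    (hdeg : ∀ v, (G.neighborSet v).ncard ≤ 3)
    (hE : ∀ H ∈ calG4, ¬ Nonempty (G ≃g H.2)) :
    isolNum C4 G ≤ Fintype.card V / 5 := by
  classical
  by_cases h4 : Fintype.card V = 4
  · refine (SquareIsolation.isolNum_C4_le_card (D := ∅) fun a b c d h => ?_).trans (Nat.zero_le _)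
    obtain ⟨H, hH, hiso⟩ := h.exists_iso h4
    exact (hE H hH hiso).elim
  · obtain ⟨D, hD, hk⟩ := SquareIsolation.good_of_conn (SquareIsolation.subcubic_of_ncard hdeg)
      Finset.univ (SquareIsolation.conn_univ hG) (by rwa [Finset.card_univ])
    rw [Finset.card_univ] at hD
    refine (SquareIsolation.isolNum_C4_le_card (D := D) fun a b c d h => ?_).trans
      ((Nat.le_div_iff_mul_le (by norm_num)).2 (by omega))
    exact hk a (Finset.mem_univ _) b (Finset.mem_univ _) c (Finset.mem_univ _) d
      (Finset.mem_univ _) h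
end

section
/- For every graph G in G_9 (i.e., each of G_1, G_2, G_3, G_4, G_5, G_6), the C_4-isolation number of G satisfies ι(G, C_4) = 2. -/
open SimpleGraph

/-- A subgraph copy of `C₄` is the same as four distinct vertices, cyclically adjacent. -/
theorem hasCopy_C4_iff {V : Type*} (G : SimpleGraph V) :
    HasCopy C4 G ↔ ∃ a b c d, G.Adj a b ∧ G.Adj b c ∧ G.Adj c d ∧ G.Adj d a ∧ a ≠ c ∧ b ≠ d := by
  constructor
  · rintro ⟨f, hf⟩
    refine ⟨f 0, f 1, f 2, f 3, hf ?_, hf ?_, hf ?_, hf ?_,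
      f.injective.ne (by decide), f.injective.ne (by decide)⟩ <;>
    simp only [C4, cycleGraph_adj] <;> decide
  · rintro ⟨a, b, c, d, hab, hbc, hcd, hda, hac, hbd⟩
    have hinj : Function.Injective ![a, b, c, d] := by
      have := hab.ne
      have := hbc.ne
      have := hcd.ne
      have := hda.ne
      intro i j hij
      fin_cases i <;> fin_cases j <;> simp_all
    refine ⟨⟨![a, b, c, d], hinj⟩, fun i j hij => ?_⟩
    simp only [C4, cycleGraph_adj] at hij
    fin_cases i <;> fin_cases j <;>
      first
      | exact absurd hij (by decide)
      | simpa using by first | assumption | exact SimpleGraph.Adj.symm (by assumption)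

/-- If no closed neighbourhood of a single vertex meets every `4`-cycle, but the closed
neighbourhood of some pair of vertices leaves fewer than four vertices, then the
`C₄`-isolation number is `2`. -/
theorem isolNum_C4_eq_two {V : Type*} [Fintype V] [DecidableEq V] [Nonempty V]
    (G : SimpleGraph V) [DecidableRel G.Adj]
    (hone : ∀ v, ∃ a, (v ≠ a ∧ ¬ G.Adj v a) ∧ ∃ b, (v ≠ b ∧ ¬ G.Adj v b ∧ G.Adj a b) ∧
      ∃ c, (v ≠ c ∧ ¬ G.Adj v c ∧ G.Adj b c ∧ a ≠ c) ∧
      ∃ d, (v ≠ d ∧ ¬ G.Adj v d ∧ G.Adj c d ∧ G.Adj d a ∧ b ≠ d))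
    (htwo : ∃ u v, u ≠ v ∧
      (Finset.univ.filter fun w => w ≠ u ∧ w ≠ v ∧ ¬ G.Adj u w ∧ ¬ G.Adj v w).card < 4) :
    isolNum C4 G = 2 := by
  apply le_antisymm
  · obtain ⟨u, v, huv, hcard⟩ := htwo
    refine Nat.sInf_le ⟨{u, v}, Set.ncard_pair huv, ?_⟩
    rintro ⟨f, -⟩
    refine hcard.not_ge ?_
    have := Finset.card_le_card_of_injOn (s := (Finset.univ : Finset (Fin 4)))
      (t := Finset.univ.filter fun w => w ≠ u ∧ w ≠ v ∧ ¬ G.Adj u w ∧ ¬ G.Adj v w)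
      (fun i => (f i : V)) ?_ (fun i _ j _ h => f.injective (Subtype.ext h))
    · simpa using this
    · intro i _
      have := (f i).2
      simp only [closedNbhd, Set.mem_compl_iff, Set.mem_union, Set.mem_insert_iff,
        Set.mem_singleton_iff, Set.mem_ofPred_eq, exists_eq_or_imp, exists_eq_left] at this
      simp only [Finset.coe_filter_univ, Set.mem_ofPred_eq]
      tauto
  · refine le_csInf ⟨_, Set.univ, rfl, fun ⟨f, _⟩ => (f 0).2 (Or.inl trivial)⟩ ?_
    rintro k ⟨D, rfl, hD⟩
    by_contra! hlt
    obtain ⟨v, hv⟩ := (Set.ncard_le_one_iff_subset_singleton (Set.toFinite D)).1 (by omega)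
    obtain ⟨a, ha, b, hb, c, hc, d, hd⟩ := hone v
    have mem : ∀ w, v ≠ w → ¬ G.Adj v w → w ∈ (closedNbhd G D)ᶜ := by
      rintro w hne hadj (hw | ⟨x, hx, hxw⟩)
      · exact hne (hv hw).symm
      · exact hadj (hv hx ▸ hxw)
    refine hD ((hasCopy_C4_iff _).2 ⟨⟨a, mem a ha.1 ha.2⟩, ⟨b, mem b hb.1 hb.2.1⟩,
      ⟨c, mem c hc.1 hc.2.1⟩, ⟨d, mem d hd.1 hd.2.1⟩, ?_⟩)
    simp only [comap_adj, Function.Embedding.subtype_apply, ne_eq, Subtype.mk.injEq]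
    exact ⟨hb.2.2, hc.2.2.1, hd.2.2.1, hd.2.2.2.1, hc.2.2.2, hd.2.2.2.2⟩

instance : DecidableRel Gr1.Adj := fun a b => by unfold Gr1; infer_instance
instance : DecidableRel Gr2.Adj := fun a b => by unfold Gr2; infer_instance
instance : DecidableRel Gr3.Adj := fun a b => by unfold Gr3; infer_instance
instance : DecidableRel Gr4.Adj := fun a b => by unfold Gr4; infer_instance
instance : DecidableRel Gr5.Adj := fun a b => by unfold Gr5; infer_instance
instance : DecidableRel Gr6.Adj := fun a b => by unfold Gr6; infer_instance

set_option maxRecDepth 100000 in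
/-- Every graph in `𝒢₉` has `C₄`-isolation number `2`. -/
theorem stmt10 : ∀ G ∈ ({Gr1, Gr2, Gr3, Gr4, Gr5, Gr6} : Set (SimpleGraph (Fin 9))),
    isolNum C4 G = 2 := by
  rintro G (rfl | rfl | rfl | rfl | rfl | rfl) <;>
    exact isolNum_C4_eq_two _ (by decide) (by decide)
end
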